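/- arXiv:1907.06461 — 2 statements merged into one kernel-verified Lean document; each statement's English description precedes it below -/
import Mathlib

section
/- Let n ≥ 2, 0 < α < n, and u(t) = e / exp(t^{−α}). Then there exists a homeomorphism h : 𝔹 → 𝔹_u with finite conformal energy (h ∈ W^{1,n}(𝔹, ℝⁿ)) whose inverse f = h⁻¹ : 𝔹_u → 𝔹 is Lipschitz continuous. -/
open MeasureTheory Metric Set
open scoped ENNReal NNReal

noncomputable section

abbrev Euc (n : ℕ) : Type := EuclideanSpace ℝ (Fin n)

/-- Operator norm of an `n × n` real matrix, viewed as a linear operator on Euclidean space. -/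
noncomputable def opNorm {n : ℕ} (M : Matrix (Fin n) (Fin n) ℝ) : ℝ :=
  ‖LinearMap.toContinuousLinearMap (Matrix.toEuclideanLin M)‖

/-- `g` belongs to the Sobolev class `W^{1,p}(Ω, ℝⁿ)` with weak differential `Dg`:
`g` and `Dg` are locally integrable on `Ω`, the integration-by-parts identity holds against
every smooth compactly supported test function supported in `Ω`, and `|Dg| ∈ L^p(Ω)`. -/
structure MemSobolev {n : ℕ} (p : ℝ) (Ω : Set (Euc n))
    (g : Euc n → Euc n) (Dg : Euc n → Matrix (Fin n) (Fin n) ℝ) : Prop where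
  locInt : ∀ i : Fin n, LocallyIntegrableOn (fun x => g x i) Ω volume
  locIntD : ∀ i j : Fin n, LocallyIntegrableOn (fun x => Dg x i j) Ω volume
  parts : ∀ φ : Euc n → ℝ, ContDiff ℝ ((⊤ : ℕ∞) : WithTop ℕ∞) φ → HasCompactSupport φ →
    tsupport φ ⊆ Ω → ∀ i j : Fin n,
      ∫ x in Ω, g x i * fderiv ℝ φ x (EuclideanSpace.single j 1) =
        - ∫ x in Ω, Dg x i j * φ x
  lp : IntegrableOn (fun x => opNorm (Dg x) ^ p) Ω volume

/-- `g` belongs to the local Sobolev class `W^{1,1}_loc(Ω, ℝⁿ)` with weak differential `Dg`. -/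
structure MemSobolevLoc {n : ℕ} (Ω : Set (Euc n))
    (g : Euc n → Euc n) (Dg : Euc n → Matrix (Fin n) (Fin n) ℝ) : Prop where
  locInt : ∀ i : Fin n, LocallyIntegrableOn (fun x => g x i) Ω volume
  locIntD : ∀ i j : Fin n, LocallyIntegrableOn (fun x => Dg x i j) Ω volume
  parts : ∀ φ : Euc n → ℝ, ContDiff ℝ ((⊤ : ℕ∞) : WithTop ℕ∞) φ → HasCompactSupport φ →
    tsupport φ ⊆ Ω → ∀ i j : Fin n,
      ∫ x in Ω, g x i * fderiv ℝ φ x (EuclideanSpace.single j 1) =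
        - ∫ x in Ω, Dg x i j * φ x

/-- `h : 𝕏 → 𝕐` is a homeomorphism of `𝕏` onto `𝕐` with inverse `f`. -/
structure IsHomeoOn {n : ℕ} (h f : Euc n → Euc n) (𝕏 𝕐 : Set (Euc n)) : Prop where
  mapsTo : Set.MapsTo h 𝕏 𝕐
  mapsTo_inv : Set.MapsTo f 𝕐 𝕏
  left_inv : ∀ x ∈ 𝕏, f (h x) = x
  right_inv : ∀ y ∈ 𝕐, h (f y) = y
  continuousOn : ContinuousOn h 𝕏
  continuousOn_inv : ContinuousOn f 𝕐

/-- The inner distortion function `K_I(·, h)` of a Sobolev map with weak differential `Dh`;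
`D♯h` is the cofactor (adjugate) matrix, given by Cramer's rule `(D♯h)(Dh) = (det Dh)·Id`. -/
noncomputable def innerDistortion {n : ℕ} (Dh : Euc n → Matrix (Fin n) (Fin n) ℝ)
    (x : Euc n) : ℝ≥0∞ :=
  if 0 < (Dh x).det then
    ENNReal.ofReal (opNorm ((Dh x).adjugate) ^ n / (Dh x).det ^ (n - 1))
  else if (Dh x).adjugate = 0 then 1 else ⊤

/-- The open unit ball `𝔹 ⊂ ℝⁿ`. -/
def unitBall (n : ℕ) : Set (Euc n) := Metric.ball 0 1

/-- The slit `I = {(t,0) : 0 ≤ t < 1}`, the first coordinate playing the role of `t`. -/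
def slit (n : ℕ) [NeZero n] : Set (Euc n) :=
  {p | 0 ≤ p 0 ∧ p 0 < 1 ∧ ∀ i : Fin n, i ≠ 0 → p i = 0}

/-- The model inward-cusp ball `𝔹_u = 𝔹 \ {(t,x) : t ≥ 0, |x| ≤ u(t)}`. -/
noncomputable def cuspBall (n : ℕ) [NeZero n] (u : ℝ → ℝ) : Set (Euc n) :=
  Metric.ball 0 1 \
    {p | 0 ≤ p 0 ∧ Real.sqrt (∑ i ∈ Finset.univ.erase (0 : Fin n), p i ^ 2) ≤ u (p 0)}

/-- `u` is a model cusp profile: a strictly increasing continuous surjection of `[0,∞)` onto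
itself, `C¹` on `(0,∞)`, with `u′` increasing on `(0,∞)`, `u′(s) → 0` as `s → 0⁺`, `u(1) = 1`. -/
structure IsModelCusp (u : ℝ → ℝ) : Prop where
  continuousOn : ContinuousOn u (Set.Ici 0)
  contDiffOn : ContDiffOn ℝ 1 u (Set.Ioi 0)
  strictMonoOn : StrictMonoOn u (Set.Ici 0)
  mapsTo : Set.MapsTo u (Set.Ici 0) (Set.Ici 0)
  surjOn : Set.SurjOn u (Set.Ici 0) (Set.Ici 0)
  deriv_mono : MonotoneOn (deriv u) (Set.Ioi 0)
  deriv_tendsto : Filter.Tendsto (deriv u) (nhdsWithin 0 (Set.Ioi 0)) (nhds 0)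
  one : u 1 = 1

/-- The cusp profile `u(t) = e / exp(t^{-α})` for `t > 0`, and `u(0) = 0`. -/
noncomputable def cuspFun (α : ℝ) (t : ℝ) : ℝ :=
  if 0 < t then Real.exp 1 / Real.exp (t ^ (-α)) else 0

/-- The sphere `S_t = {y ∈ 𝔹_u : |y| = t}` inside the cusp ball. -/
def cuspS (n : ℕ) [NeZero n] (u : ℝ → ℝ) (t : ℝ) : Set (Euc n) :=
  {y ∈ cuspBall n u | ‖y‖ = t}

/-- The boundary circle `C_t = {y ∈ ∂𝔹_u : |y| = t}`. -/
def cuspC (n : ℕ) [NeZero n] (u : ℝ → ℝ) (t : ℝ) : Set (Euc n) :=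
  {y ∈ frontier (cuspBall n u) | ‖y‖ = t}

/-- `S′_t = h⁻¹(S_t) ⊆ 𝔹`. -/
def cuspS' (n : ℕ) [NeZero n] (u : ℝ → ℝ) (h : Euc n → Euc n) (t : ℝ) : Set (Euc n) :=
  {x ∈ unitBall n | h x ∈ cuspS n u t}

/-- `C′_t = cl(S′_t) ∩ ∂𝔹`. -/
def cuspC' (n : ℕ) [NeZero n] (u : ℝ → ℝ) (h : Euc n → Euc n) (t : ℝ) : Set (Euc n) :=
  closure (cuspS' n u h t) ∩ Metric.sphere (0 : Euc n) 1

section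
open Real

def qf (r : ℝ) : ℝ := √(1 - r^2)
def wf (α r : ℝ) : ℝ := (1 - log r) ^ (-α⁻¹)
def mf (r : ℝ) : ℝ := (1 - r) * qf r
def cF (α t r : ℝ) : ℝ := mf r + (2 - r) * min t 0 + max t 0 * max (qf r * (r / wf α r)) r
def cH (α T r : ℝ) : ℝ := min (T - mf r) 0 / (2 - r) + max (T - mf r) 0 * (min (wf α r / qf r) 1 / r)

lemma qf_nonneg (r : ℝ) : 0 ≤ qf r := Real.sqrt_nonneg _
lemma qf_sq {r : ℝ} (h0 : 0 ≤ r) (h1 : r < 1) : qf r ^ 2 = 1 - r^2 :=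
  Real.sq_sqrt (by nlinarith)
lemma qf_pos {r : ℝ} (h0 : 0 ≤ r) (h1 : r < 1) : 0 < qf r :=
  Real.sqrt_pos.2 (by nlinarith)
lemma qf_le_one {r : ℝ} (h0 : 0 ≤ r) (h1 : r < 1) : qf r ≤ 1 := by
  have := qf_sq h0 h1
  nlinarith [qf_nonneg r]
lemma lt_qf {r t : ℝ} (h0 : 0 ≤ r) (h1 : t^2 + r^2 < 1) : |t| < qf r := by
  unfold qf
  apply Real.lt_sqrt_of_sq_lt
  rw [sq_abs]; linarith
lemma qf_anti {r r' : ℝ} (h0 : 0 ≤ r) (h : r ≤ r') : qf r' ≤ qf r := by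
  apply Real.sqrt_le_sqrt; nlinarith
lemma qf_diff {r r' : ℝ} (h0 : 0 ≤ r) (h : r ≤ r') (h1 : r' < 1) :
    (qf r - qf r') * qf r ≤ 2 * (r' - r) := by
  have a := qf_sq h0 (h.trans_lt h1)
  have b := qf_sq (h0.trans h) h1
  have c := qf_anti h0 h
  nlinarith [qf_nonneg r', qf_nonneg r]

lemma mf_lip_aux {r r' : ℝ} (h0 : 0 ≤ r) (h : r ≤ r') (h1 : r' < 1) :
    |mf r - mf r'| ≤ 3 * (r' - r) := by
  have e : mf r - mf r' = (r' - r) * qf r + (1 - r') * (qf r - qf r') := by unfold mf; ring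
  have a := qf_sq h0 (h.trans_lt h1)
  have c := qf_anti h0 h
  have d := qf_diff h0 h h1
  have hq := qf_le_one h0 (h.trans_lt h1)
  have hn := qf_nonneg r
  have k : (1 - r') * (qf r - qf r') ≤ 2 * (r' - r) := by
    have : (1 - r') ≤ qf r := by nlinarith
    nlinarith
  rw [e, abs_of_nonneg]
  · nlinarith
  · have : 0 ≤ (1 - r') * (qf r - qf r') := mul_nonneg (by linarith) (by linarith)
    have : 0 ≤ (r' - r) * qf r := mul_nonneg (by linarith) hn
    linarith

lemma mf_lip {r r' : ℝ} (h0 : 0 ≤ r) (h1 : r < 1) (h0' : 0 ≤ r') (h1' : r' < 1) :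
    |mf r - mf r'| ≤ 3 * |r - r'| := by
  rcases le_total r r' with h | h
  · have := mf_lip_aux h0 h h1'
    rwa [abs_sub_comm r, abs_of_nonneg (sub_nonneg.2 h)]
  · have := mf_lip_aux h0' h h1
    rwa [abs_sub_comm (mf r), abs_of_nonneg (sub_nonneg.2 h)]

lemma L_one_le {r : ℝ} (h0 : 0 < r) (h1 : r ≤ 1) : 1 ≤ 1 - log r := by
  have := Real.log_nonpos h0.le h1; linarith
lemma wf_pos (α : ℝ) {r : ℝ} (h0 : 0 < r) (h1 : r ≤ 1) : 0 < wf α r :=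
  Real.rpow_pos_of_pos (by linarith [L_one_le h0 h1]) _
lemma wf_le_one {α r : ℝ} (ha : 0 < α) (h0 : 0 < r) (h1 : r ≤ 1) : wf α r ≤ 1 :=
  Real.rpow_le_one_of_one_le_of_nonpos (L_one_le h0 h1) (by simp [ha.le])
lemma wf_mono {α r r' : ℝ} (ha : 0 < α) (h0 : 0 < r) (h : r ≤ r') (h1 : r' ≤ 1) :
    wf α r ≤ wf α r' := by
  apply Real.rpow_le_rpow_of_nonpos (by linarith [L_one_le (h0.trans_le h) h1])
  · linarith [Real.log_le_log h0 h]
  · simp [ha.le]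

/-- `g` is bounded. -/
lemma g_bdd {α : ℝ} (ha : 0 < α) : ∃ C : ℝ, 0 < C ∧ ∀ r, 0 < r → r ≤ 1 → r / wf α r ≤ C := by
  refine ⟨(1 + α⁻¹) ^ α⁻¹, by positivity, fun r h0 h1 => ?_⟩
  have hL := L_one_le h0 h1
  have h2 : 1 - log r ≤ r ^ (-α) * (1 + α⁻¹) := by
    have h3 := Real.log_le_rpow_div (x := r⁻¹) (by positivity) ha
    rw [Real.log_inv, Real.inv_rpow h0.le, ← Real.rpow_neg h0.le] at h3
    have h4 : 1 ≤ r ^ (-α) := Real.one_le_rpow_of_pos_of_le_one_of_nonpos h0 h1 (by linarith)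
    rw [div_eq_mul_inv] at h3
    nlinarith
  have h5 : (1 - log r) ^ α⁻¹ ≤ r⁻¹ * (1 + α⁻¹) ^ α⁻¹ := by
    calc _ ≤ (r ^ (-α) * (1 + α⁻¹)) ^ α⁻¹ :=
          Real.rpow_le_rpow (by linarith) h2 (by positivity)
      _ = _ := by
        rw [Real.mul_rpow (by positivity) (by positivity), ← Real.rpow_mul h0.le]
        rw [show -α * α⁻¹ = -1 by field_simp, Real.rpow_neg_one]
  unfold wf
  rw [Real.rpow_neg (by linarith), div_inv_eq_mul]
  calc _ ≤ r * (r⁻¹ * (1 + α⁻¹) ^ α⁻¹) := by gcongr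
    _ = _ := by field_simp

lemma wf_hasDerivAt (α : ℝ) {r : ℝ} (h0 : 0 < r) (h1 : r ≤ 1) :
    HasDerivAt (wf α) (α⁻¹ * (wf α r / (1 - log r)) / r) r := by
  have hL := L_one_le h0 h1
  have := ((Real.hasDerivAt_log h0.ne').const_sub 1).rpow_const (p := -α⁻¹) (Or.inl (by linarith))
  unfold wf
  convert this using 1
  rw [Real.rpow_sub_one (by linarith)]
  field_simp

/-- local Lipschitz estimate for `w`. -/
lemma wf_lip {α : ℝ} (ha : 0 < α) {a b B r r' : ℝ} (h0 : 0 < a) (hb : b ≤ 1)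
    (hB : ∀ x, a < x → x < b → wf α x ≤ B)
    (hr : r ∈ Set.Ioo a b) (hr' : r' ∈ Set.Ioo a b) :
    |wf α r - wf α r'| ≤ α⁻¹ * B / a * |r - r'| := by
  have := Convex.norm_image_sub_le_of_norm_hasDerivWithin_le (𝕜 := ℝ) (f := wf α)
    (f' := fun r => α⁻¹ * (wf α r / (1 - log r)) / r) (s := Set.Ioo a b)
    (C := α⁻¹ * B / a)
    (fun x hx => (wf_hasDerivAt α (h0.trans hx.1) (hx.2.le.trans hb)).hasDerivWithinAt)
    (fun x hx => by
      have hx0 := h0.trans hx.1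
      have hL := L_one_le hx0 (hx.2.le.trans hb)
      have hw := wf_pos α hx0 (hx.2.le.trans hb)
      have hxB := hB x hx.1 hx.2
      rw [Real.norm_eq_abs, abs_of_nonneg (by positivity)]
      have : wf α x / (1 - log x) ≤ B := (div_le_self hw.le hL).trans hxB
      have hB0 : 0 ≤ B := hw.le.trans hxB
      gcongr
      exact hx.1.le) (convex_Ioo a b) hr' hr
  simpa [Real.norm_eq_abs] using this

lemma g_lip {α : ℝ} (ha : 0 < α) {r r' : ℝ} (h0 : 0 < r) (h : r ≤ r') (h1 : r' ≤ 1) :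
    wf α r * |r / wf α r - r' / wf α r'| ≤ (1 + α⁻¹) * (r' - r) := by
  have hw := wf_pos α h0 (h.trans h1)
  have := Convex.norm_image_sub_le_of_norm_hasDerivWithin_le (𝕜 := ℝ) (f := fun x => x / wf α x)
    (f' := fun x => (1 * wf α x - x * (α⁻¹ * (wf α x / (1 - log x)) / x)) / wf α x ^ 2)
    (s := Set.Icc r r') (C := (1 + α⁻¹) / wf α r)
    (fun x hx => ((hasDerivAt_id' x).div (wf_hasDerivAt α (h0.trans_le hx.1) (hx.2.trans h1))
      (wf_pos α (h0.trans_le hx.1) (hx.2.trans h1)).ne').hasDerivWithinAt)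
    (fun x hx => by
      have hx0 := h0.trans_le hx.1
      have hL := L_one_le hx0 (hx.2.trans h1)
      have hwx := wf_pos α hx0 (hx.2.trans h1)
      have hm := wf_mono ha h0 hx.1 (hx.2.trans h1)
      have hL0 : 0 < 1 - log x := by linarith
      have e : (1 * wf α x - x * (α⁻¹ * (wf α x / (1 - log x)) / x)) / wf α x ^ 2
        = (1 - α⁻¹ * (1 / (1 - log x))) / wf α x := by field_simp
      rw [e, norm_div, Real.norm_eq_abs, Real.norm_eq_abs, abs_of_pos hwx]
      have h3 : 1 / (1 - log x) ≤ 1 := by rw [div_le_one hL0]; exact hL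
      have h4 : 0 ≤ 1 / (1 - log x) := by positivity
      have h5 : 0 < α⁻¹ := by positivity
      have : |1 - α⁻¹ * (1 / (1 - log x))| ≤ 1 + α⁻¹ := by
        rw [abs_le]; constructor <;> nlinarith
      gcongr) (convex_Icc r r') (Set.right_mem_Icc.2 h) (Set.left_mem_Icc.2 h)
  simp only [Real.norm_eq_abs] at this
  rw [abs_sub_comm r r', abs_of_nonneg (sub_nonneg.2 h)] at this
  calc _ ≤ wf α r * ((1 + α⁻¹) / wf α r * (r' - r)) := by gcongr
    _ = _ := by field_simp

end


section
open Real


lemma ball_lt_one {t r : ℝ} (h0 : 0 ≤ r) (h : t^2 + r^2 < 1) : r < 1 := by nlinarith [sq_nonneg t]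

lemma mf_nonneg {r : ℝ} (h1 : r < 1) : 0 ≤ mf r := mul_nonneg (by linarith) (qf_nonneg r)
lemma mf_le {r : ℝ} (h0 : 0 ≤ r) : mf r ≤ qf r := by
  have := qf_nonneg r; unfold mf; nlinarith

/-- planar description of the cusp ball -/
def InC (α t r : ℝ) : Prop := 0 ≤ r ∧ t^2 + r^2 < 1 ∧ (0 ≤ t → 0 < r ∧ t < wf α r)

lemma cF_neg {α t r : ℝ} (ht : t ≤ 0) : cF α t r = mf r + (2 - r) * t := by
  simp [cF, ht]
lemma cF_pos {α t r : ℝ} (ht : 0 ≤ t) : cF α t r = mf r + t * max (qf r * (r / wf α r)) r := by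
  simp [cF, ht]
lemma cH_neg {α T r : ℝ} (ht : T ≤ mf r) : cH α T r = (T - mf r) / (2 - r) := by
  simp [cH, ht]
lemma cH_pos {α T r : ℝ} (ht : mf r ≤ T) :
    cH α T r = (T - mf r) * (min (wf α r / qf r) 1 / r) := by
  simp [cH, ht]

lemma max_min_inv {α r : ℝ} (h0 : 0 < r) (h1 : r < 1) :
    max (qf r * (r / wf α r)) r * (min (wf α r / qf r) 1 / r) = 1 := by
  have hq := qf_pos h0.le h1
  have hw := wf_pos α h0 h1.le
  rcases le_total (wf α r) (qf r) with h | h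
  · rw [max_eq_left, min_eq_left]
    · field_simp
    · rwa [div_le_one hq]
    · rw [mul_div_assoc', le_div_iff₀ hw, mul_comm]; gcongr
  · rw [max_eq_right, min_eq_right]
    · field_simp
    · rwa [one_le_div hq]
    · rw [mul_div_assoc', div_le_iff₀ hw, mul_comm]; gcongr

lemma pos_of_mf_le {T r : ℝ} (h0 : 0 ≤ r) (h : T^2 + r^2 < 1) (hT : mf r ≤ T) : 0 < r := by
  rcases h0.eq_or_lt with h' | h'
  · subst h'
    have := (abs_lt.1 (lt_qf le_rfl h)).2
    simp [mf] at hT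
    linarith
  · exact h'

lemma cF_cH {α T r : ℝ} (h0 : 0 ≤ r) (h : T^2 + r^2 < 1) : cF α (cH α T r) r = T := by
  have h1 := ball_lt_one h0 h
  rcases le_total T (mf r) with hT | hT
  · rw [cH_neg hT, cF_neg]
    · field_simp [show (2 - r) ≠ 0 by linarith]; ring
    · apply div_nonpos_of_nonpos_of_nonneg <;> linarith
  · have hr := pos_of_mf_le h0 h hT
    have hq := qf_pos h0 h1
    have hw := wf_pos α hr h1.le
    rw [cH_pos hT, cF_pos]
    · have := max_min_inv (α := α) hr h1
      rw [mul_assoc, mul_comm (min _ _ / r), this]; ring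
    · have : 0 ≤ T - mf r := by linarith
      positivity

lemma cH_cF {α t r : ℝ} (h : InC α t r) : cH α (cF α t r) r = t := by
  obtain ⟨h0, hb, hc⟩ := h
  have h1 := ball_lt_one h0 hb
  rcases le_total t 0 with ht | ht
  · rw [cF_neg ht, cH_neg]
    · field_simp [show (2 - r) ≠ 0 by linarith]; ring
    · nlinarith
  · have hr := (hc ht).1
    rw [cF_pos ht, cH_pos]
    · have := max_min_inv (α := α) hr h1
      rw [add_sub_cancel_left, mul_assoc, this, mul_one]
    · have : 0 ≤ max (qf r * (r / wf α r)) r := h0.trans (le_max_right _ _)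
      nlinarith

lemma sq_lt_of_qf {T r : ℝ} (h0 : 0 ≤ r) (h1 : r < 1) (h : |T| < qf r) : T^2 + r^2 < 1 := by
  have := qf_sq h0 h1
  have := sq_lt_sq' (by linarith [abs_nonneg T]) h
  rw [sq_abs] at this
  linarith

lemma cH_mem {α T r : ℝ} (h0 : 0 ≤ r) (h : T^2 + r^2 < 1) : InC α (cH α T r) r := by
  have h1 := ball_lt_one h0 h
  have hq := qf_pos h0 h1
  have hT' := abs_lt.1 (lt_qf h0 h)
  have hm := mf_nonneg h1
  have hm' := mf_le h0
  rcases lt_or_ge T (mf r) with hT | hT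
  · have hneg : cH α T r < 0 := by
      rw [cH_neg hT.le]; apply div_neg_of_neg_of_pos <;> linarith
    refine ⟨h0, sq_lt_of_qf h0 h1 ?_, fun h => absurd h (not_le.2 hneg)⟩
    rw [abs_of_neg hneg, cH_neg hT.le, ← neg_div, div_lt_iff₀ (by linarith)]
    unfold mf; nlinarith
  · have hr := pos_of_mf_le h0 h hT
    have hw := wf_pos α hr h1.le
    have hz : 0 ≤ T - mf r := by linarith
    have hz' : T - mf r < r * qf r := by unfold mf; nlinarith
    have hb : 0 < min (wf α r / qf r) 1 / r := by positivity
    have hpos : 0 ≤ cH α T r := by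
      rw [cH_pos hT]; positivity
    have key : cH α T r < qf r * min (wf α r / qf r) 1 := by
      rw [cH_pos hT]
      calc _ < r * qf r * (min (wf α r / qf r) 1 / r) := by gcongr
        _ = _ := by field_simp
    refine ⟨h0, sq_lt_of_qf h0 h1 ?_, fun _ => ⟨hr, ?_⟩⟩
    · rw [abs_of_nonneg hpos]
      refine key.trans_le ?_
      have := min_le_right (wf α r / qf r) 1
      nlinarith
    · refine key.trans_le ?_
      calc _ ≤ qf r * (wf α r / qf r) := by gcongr; exact min_le_left _ _
        _ = _ := by field_simp

lemma cF_mem {α t r : ℝ} (h : InC α t r) : (cF α t r)^2 + r^2 < 1 := by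
  obtain ⟨h0, hb, hc⟩ := h
  have h1 := ball_lt_one h0 hb
  have hq := qf_pos h0 h1
  have ht' := abs_lt.1 (lt_qf h0 hb)
  apply sq_lt_of_qf h0 h1
  rw [abs_lt]
  rcases lt_or_ge t 0 with ht | ht
  · rw [cF_neg ht.le]
    unfold mf
    constructor
    · nlinarith
    · nlinarith
  · obtain ⟨hr, htw⟩ := hc ht
    have hw := wf_pos α hr h1.le
    rw [cF_pos ht]
    have hM : t * max (qf r * (r / wf α r)) r < r * qf r := by
      rcases max_cases (qf r * (r / wf α r)) r with ⟨e, -⟩ | ⟨e, -⟩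
      · rw [e]
        calc t * (qf r * (r / wf α r)) < wf α r * (qf r * (r / wf α r)) := by gcongr
          _ = _ := by field_simp
      · rw [e]; nlinarith
    have hM0 : 0 ≤ t * max (qf r * (r / wf α r)) r := mul_nonneg ht (h0.trans (le_max_right _ _))
    have := mf_nonneg h1
    constructor
    · linarith
    · unfold mf at *; linarith

set_option maxHeartbeats 2000000 in
lemma cF_lip_aux {α : ℝ} (ha : 0 < α) : ∃ C : ℝ, 0 ≤ C ∧ ∀ t r t' r', InC α t r → InC α t' r' →
    r ≤ r' → |cF α t r - cF α t' r'| ≤ C * (|t - t'| + |r - r'|) := by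
  obtain ⟨G, hG0, hG⟩ := g_bdd ha
  refine ⟨3 + (2 + 1) + ((1 + α⁻¹) + G + 2 * G + 1 + 1), by positivity, ?_⟩
  rintro t r t' r' ⟨h0, hb, hc⟩ ⟨h0', hb', hc'⟩ hrr
  have h1 := ball_lt_one h0 hb
  have h1' := ball_lt_one h0' hb'
  have hm := mf_lip h0 h1 h0' h1'
  have ht1 := abs_lt.1 (lt_qf h0 hb)
  have ht1' := abs_lt.1 (lt_qf h0' hb')
  have hq1 := qf_le_one h0 h1
  have hq1' := qf_le_one h0' h1'
  have hq := qf_pos h0 h1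
  have hq' := qf_pos h0' h1'
  have hΔr : |r - r'| = r' - r := by rw [abs_sub_comm, abs_of_nonneg (sub_nonneg.2 hrr)]
  -- lower term
  have hmin : |min t 0 - min t' 0| ≤ |t - t'| := by
    simpa using abs_min_sub_min_le_max t 0 t' 0
  have hmax : |max t 0 - max t' 0| ≤ |t - t'| := by
    simpa using abs_max_sub_max_le_max t 0 t' 0
  have hΔt := abs_nonneg (t - t')
  have hΔr0 := abs_nonneg (r - r')
  have hmn : |min t' 0| ≤ 1 := by
    rw [abs_le]; constructor
    · apply le_min <;> linarith
    · exact (min_le_right _ _).trans (by norm_num)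
  have low : |(2 - r) * min t 0 - (2 - r') * min t' 0| ≤ 2 * |t - t'| + |r - r'| := by
    have e : (2 - r) * min t 0 - (2 - r') * min t' 0
      = (2 - r) * (min t 0 - min t' 0) - (r - r') * min t' 0 := by ring
    rw [e]
    refine (abs_sub _ _).trans ?_
    rw [abs_mul, abs_mul, abs_of_pos (by linarith : (0:ℝ) < 2 - r)]
    have := abs_nonneg (min t 0 - min t' 0)
    nlinarith
  -- upper terms
  have hp0 : 0 ≤ max t 0 := le_max_right _ _
  have hp0' : 0 ≤ max t' 0 := le_max_right _ _
  have hp1 : max t 0 ≤ 1 := max_le (by linarith) (by norm_num)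
  have hpq' : max t' 0 ≤ qf r' := max_le (by linarith) hq'.le
  have up2 : |max t 0 * r - max t' 0 * r'| ≤ |t - t'| + |r - r'| := by
    have e : max t 0 * r - max t' 0 * r' = max t 0 * (r - r') + (max t 0 - max t' 0) * r' := by ring
    rw [e]
    refine (abs_add_le _ _).trans ?_
    rw [abs_mul, abs_mul, abs_of_nonneg hp0, abs_of_nonneg h0']
    have := abs_nonneg (max t 0 - max t' 0)
    nlinarith
  have hg' : r' / wf α r' ≤ G ∧ 0 ≤ r' / wf α r' := by
    rcases h0'.eq_or_lt with h | h
    · rw [← h]; simp [hG0.le]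
    · have := wf_pos α h h1'.le
      exact ⟨hG r' h h1'.le, by positivity⟩
  have gg : max t 0 * |r / wf α r - r' / wf α r'| ≤ (1 + α⁻¹) * |r - r'| := by
    rcases le_total t 0 with ht | ht
    · rw [max_eq_right ht, zero_mul]; positivity
    · obtain ⟨hr, htw⟩ := hc ht
      rw [max_eq_left ht]
      have := g_lip ha hr hrr h1'.le
      rw [hΔr]
      refine le_trans ?_ this
      gcongr
  have hqd : max t' 0 * |qf r - qf r'| ≤ 2 * |r - r'| := by
    have := qf_diff h0 hrr h1'
    have han := qf_anti h0 hrr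
    rw [abs_of_nonneg (sub_nonneg.2 han), hΔr]
    nlinarith
  have up1 : |max t 0 * (qf r * (r / wf α r)) - max t' 0 * (qf r' * (r' / wf α r'))|
      ≤ G * |t - t'| + ((1 + α⁻¹) + 2 * G) * |r - r'| := by
    set g := r / wf α r
    set g' := r' / wf α r'
    have e : max t 0 * (qf r * g) - max t' 0 * (qf r' * g')
      = qf r * (max t 0 * (g - g')) + (g' * qf r) * (max t 0 - max t' 0)
        + g' * (max t' 0 * (qf r - qf r')) := by ring
    rw [e]
    refine (abs_add_three _ _ _).trans ?_
    have a1 : |qf r * (max t 0 * (g - g'))| ≤ (1 + α⁻¹) * |r - r'| := by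
      rw [abs_mul, abs_mul, abs_of_pos hq, abs_of_nonneg hp0]
      have : 0 ≤ max t 0 * |g - g'| := by positivity
      nlinarith
    have a2 : |(g' * qf r) * (max t 0 - max t' 0)| ≤ G * |t - t'| := by
      rw [abs_mul, abs_of_nonneg (mul_nonneg hg'.2 hq.le)]
      have : g' * qf r ≤ G := by nlinarith
      gcongr
    have a3 : |g' * (max t' 0 * (qf r - qf r'))| ≤ G * (2 * |r - r'|) := by
      rw [abs_mul, abs_mul, abs_of_nonneg hg'.2, abs_of_nonneg hp0']
      gcongr
      exact hg'.1
    linarith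
  have up : |max t 0 * max (qf r * (r / wf α r)) r - max t' 0 * max (qf r' * (r' / wf α r')) r'|
      ≤ (G + 1) * |t - t'| + ((1 + α⁻¹) + 2 * G + 1) * |r - r'| := by
    rw [mul_max_of_nonneg _ _ hp0, mul_max_of_nonneg _ _ hp0']
    refine (abs_max_sub_max_le_max _ _ _ _).trans (max_le ?_ ?_)
    · refine up1.trans ?_
      nlinarith
    · refine up2.trans ?_
      have : 0 < α⁻¹ := by positivity
      nlinarith
  have : |cF α t r - cF α t' r'| ≤ 3 * |r - r'| + (2 * |t - t'| + |r - r'|)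
      + ((G + 1) * |t - t'| + ((1 + α⁻¹) + 2 * G + 1) * |r - r'|) := by
    have e : cF α t r - cF α t' r' = (mf r - mf r') + ((2 - r) * min t 0 - (2 - r') * min t' 0)
      + (max t 0 * max (qf r * (r / wf α r)) r - max t' 0 * max (qf r' * (r' / wf α r')) r') := by
      unfold cF; ring
    rw [e]
    refine (abs_add_three _ _ _).trans ?_
    linarith
  refine this.trans ?_
  have : 0 < α⁻¹ := by positivity
  nlinarith [mul_nonneg this.le hΔt, mul_nonneg this.le hΔr0, mul_nonneg hG0.le hΔt,
    mul_nonneg hG0.le hΔr0]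

lemma cF_lip {α : ℝ} (ha : 0 < α) : ∃ C : ℝ, 0 ≤ C ∧ ∀ t r t' r', InC α t r → InC α t' r' →
    |cF α t r - cF α t' r'| ≤ C * (|t - t'| + |r - r'|) := by
  obtain ⟨C, hC, h⟩ := cF_lip_aux ha
  refine ⟨C, hC, fun t r t' r' h1 h2 => ?_⟩
  rcases le_total r r' with hr | hr
  · exact h t r t' r' h1 h2 hr
  · rw [abs_sub_comm (cF α t r), abs_sub_comm t, abs_sub_comm r]
    exact h t' r' t r h2 h1 hr

end


section
open Real


lemma wf_double {α r r0 : ℝ} (ha : 0 < α) (h0 : 0 < r0) (h0' : r0 ≤ 1) (hr : 0 < r) (h1 : r ≤ 1) (h : r ≤ 2 * r0) :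
    wf α r ≤ 2 ^ α⁻¹ * wf α r0 := by
  have hL := L_one_le hr h1
  have hL0 := L_one_le h0 h0'
  have hlog : log r ≤ log 2 + log r0 := by
    rw [← Real.log_mul (by norm_num) h0.ne']; exact Real.log_le_log hr h
  have h2 : log 2 ≤ 1 := by have := Real.log_two_lt_d9; linarith
  have key : (1 - log r0) / 2 ≤ 1 - log r := by linarith
  unfold wf
  calc (1 - log r) ^ (-α⁻¹) ≤ ((1 - log r0) / 2) ^ (-α⁻¹) :=
        Real.rpow_le_rpow_of_nonpos (by linarith) key (by simp [ha.le])
    _ = _ := by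
      rw [Real.div_rpow (by linarith) (by norm_num), Real.rpow_neg (by norm_num : (0:ℝ) ≤ 2)]
      rw [div_inv_eq_mul, mul_comm]

lemma low_lip {T r T' r' : ℝ} (h0 : 0 ≤ r) (h : T^2 + r^2 < 1) (h0' : 0 ≤ r') (h' : T'^2 + r'^2 < 1) :
    |min (T - mf r) 0 / (2 - r) - min (T' - mf r') 0 / (2 - r')| ≤ 5 * (|T - T'| + |r - r'|) := by
  have h1 : r < 1 := by nlinarith [sq_nonneg T]
  have h1' : r' < 1 := by nlinarith [sq_nonneg T']
  have hm := mf_lip h0 h1 h0' h1'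
  have hm1 : mf r' ≤ 1 := by
    have := qf_le_one h0' h1'; have := qf_nonneg r'; unfold mf; nlinarith
  have ht1' : -1 < T' := by nlinarith
  have hmin : |min (T - mf r) 0 - min (T' - mf r') 0| ≤ |T - T'| + 3 * |r - r'| := by
    have : |min (T - mf r) 0 - min (T' - mf r') 0| ≤ |(T - mf r) - (T' - mf r')| := by
      simpa using abs_min_sub_min_le_max (T - mf r) 0 (T' - mf r') 0
    refine this.trans ?_
    rw [show (T - mf r) - (T' - mf r') = (T - T') - (mf r - mf r') by ring]
    exact (abs_sub _ _).trans (by linarith)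
  have hx : |min (T' - mf r') 0| ≤ 2 := by
    rw [abs_le]; constructor
    · apply le_min <;> linarith
    · exact (min_le_right _ _).trans (by norm_num)
  set x := min (T - mf r) 0
  set x' := min (T' - mf r') 0
  have hd : 1 ≤ 2 - r := by linarith
  have hd' : 1 ≤ 2 - r' := by linarith
  have e : x / (2 - r) - x' / (2 - r') = (x - x') / (2 - r) + x' * (r - r') / ((2 - r) * (2 - r')) := by
    field_simp [show 2 - r ≠ 0 by linarith, show 2 - r' ≠ 0 by linarith]; ring
  rw [e]
  refine (abs_add_le _ _).trans ?_
  have a1 : |(x - x') / (2 - r)| ≤ |T - T'| + 3 * |r - r'| := by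
    rw [abs_div, abs_of_pos (by linarith : 0 < 2 - r)]
    exact (div_le_self (abs_nonneg _) hd).trans hmin
  have a2 : |x' * (r - r') / ((2 - r) * (2 - r'))| ≤ 2 * |r - r'| := by
    rw [abs_div, abs_of_pos (by nlinarith : 0 < (2 - r) * (2 - r')), abs_mul]
    refine (div_le_self (by positivity) (by nlinarith)).trans ?_
    gcongr
  have := abs_nonneg (T - T')
  linarith

lemma beta_eq {α c : ℝ} (hc : 0 < c) {r : ℝ} (hq : 0 < qf r) (h : qf r < c → c ≤ wf α r) :
    min (wf α r / qf r) 1 = min (wf α r / max (qf r) c) 1 := by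
  rcases lt_or_ge (qf r) c with h1 | h1
  · have := h h1
    rw [max_eq_right h1.le, min_eq_right, min_eq_right]
    · rwa [one_le_div hc]
    · rw [one_le_div hq]; linarith
  · rw [max_eq_left h1]

lemma qt_lip_aux {c r r' : ℝ} (hc : 0 < c) (h0 : 0 ≤ r) (h : r ≤ r') (h1 : r' < 1) :
    |max (qf r) c - max (qf r') c| ≤ 2 / c * (r' - r) := by
  have han := qf_anti h0 h
  have hd := qf_diff h0 h h1
  rw [abs_of_nonneg (sub_nonneg.2 (max_le_max_right _ han)), div_mul_eq_mul_div, le_div_iff₀ hc]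
  rcases le_total (qf r) c with h2 | h2
  · rw [max_eq_right h2, max_eq_right (han.trans h2)]; nlinarith
  · rw [max_eq_left h2]
    have := le_max_left (qf r') c
    nlinarith

lemma qt_lip {c r r' : ℝ} (hc : 0 < c) (h0 : 0 ≤ r) (h0' : 0 ≤ r') (h1 : r < 1) (h1' : r' < 1) :
    |max (qf r) c - max (qf r') c| ≤ 2 / c * |r - r'| := by
  rcases le_total r r' with h | h
  · rw [abs_sub_comm r, abs_of_nonneg (sub_nonneg.2 h)]; exact qt_lip_aux hc h0 h h1'
  · rw [abs_sub_comm (max _ _), abs_of_nonneg (sub_nonneg.2 h)]; exact qt_lip_aux hc h0' h h1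

set_option maxHeartbeats 2000000 in
lemma up_lip {α : ℝ} (ha : 0 < α) : ∃ C : ℝ, 0 ≤ C ∧ ∀ r0, 0 < r0 → r0 < 1 → ∀ T r T' r',
    r0 / 2 < r → r < 2 * r0 → r0 / 2 < r' → r' < 2 * r0 → T^2 + r^2 < 1 → T'^2 + r'^2 < 1 →
    |max (T - mf r) 0 * (min (wf α r / qf r) 1 / r) -
      max (T' - mf r') 0 * (min (wf α r' / qf r') 1 / r')|
      ≤ C * (wf α r0 / r0) * (|T - T'| + |r - r'|) := by
  set c := min (wf α (1/2)) (qf (1/2)) with hcdef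
  have hc : 0 < c := lt_min (wf_pos α (by norm_num) (by norm_num)) (qf_pos (by norm_num) (by norm_num))
  have hcq : ∀ r, 0 ≤ r → r < 1 → qf r < c → c ≤ wf α r := by
    intro r h0 h1 h
    have : 1 / 2 ≤ r := by
      by_contra hlt
      push Not at hlt
      have := qf_anti h0 hlt.le
      have := min_le_right (wf α (1/2)) (qf (1/2))
      linarith
    exact (min_le_left _ _).trans (wf_mono ha (by norm_num) this h1.le)
  set K := (2:ℝ) ^ α⁻¹ with hK
  have hK0 : 0 < K := by positivity
  have ha' : 0 < α⁻¹ := by positivity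
  set C1 := 2 * α⁻¹ / c + 2 / c^3 with hC1
  have hC10 : 0 < C1 := by positivity
  refine ⟨(2 * (2 * C1 + 4 / c) + 6 / c) * K, by positivity, ?_⟩
  intro r0 h0 h1 T r T' r' ha1 ha2 hb1 hb2 hT hT'
  have hr0 : 0 < r := by linarith
  have hr0' : 0 < r' := by linarith
  have hr1 : r < 1 := by nlinarith [sq_nonneg T]
  have hr1' : r' < 1 := by nlinarith [sq_nonneg T']
  have hq := qf_pos hr0.le hr1
  have hq' := qf_pos hr0'.le hr1'
  have hw0 := wf_pos α h0 h1.le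
  set A := K * wf α r0 with hA
  have hA0 : 0 < A := by positivity
  have hwA : wf α r ≤ A := wf_double ha h0 h1.le hr0 hr1.le ha2.le
  have hwA' : wf α r' ≤ A := wf_double ha h0 h1.le hr0' hr1'.le hb2.le
  have hw := wf_pos α hr0 hr1.le
  have hw' := wf_pos α hr0' hr1'.le
  set Δ := |r - r'| with hΔ
  have hΔ0 : 0 ≤ Δ := abs_nonneg _
  have wl : |wf α r - wf α r'| ≤ 2 * α⁻¹ * A / r0 * Δ := by
    have := wf_lip ha (a := r0 / 2) (b := min (2 * r0) 1) (B := A) (r := r) (r' := r')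
      (by linarith) (min_le_right _ _)
      (fun x hx hx' => wf_double ha h0 h1.le (by linarith) (hx'.le.trans (min_le_right _ _))
        (hx'.le.trans (min_le_left _ _))) ⟨ha1, lt_min ha2 hr1⟩ ⟨hb1, lt_min hb2 hr1'⟩
    refine this.trans (le_of_eq ?_)
    rw [← hΔ]
    field_simp
  have ql := qt_lip hc hr0.le hr0'.le hr1 hr1'
  rw [beta_eq hc hq (hcq r hr0.le hr1), beta_eq hc hq' (hcq r' hr0'.le hr1')]
  set Q := max (qf r) c with hQ
  set Q' := max (qf r') c with hQ'
  have hQc : c ≤ Q := le_max_right _ _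
  have hQc' : c ≤ Q' := le_max_right _ _
  have hQ0 : 0 < Q := hc.trans_le hQc
  have hQ0' : 0 < Q' := hc.trans_le hQc'
  set β := min (wf α r / Q) 1 with hβ
  set β' := min (wf α r' / Q') 1 with hβ'
  have hβ0' : 0 < β' := lt_min (by positivity) one_pos
  have hβ0 : 0 < β := lt_min (by positivity) one_pos
  have hβA' : β' ≤ A / c := (min_le_left _ _).trans (by gcongr)
  have bl : |β - β'| ≤ C1 * A / r0 * Δ := by
    have s1 : |β - β'| ≤ |wf α r / Q - wf α r' / Q'| := by
      simpa using abs_min_sub_min_le_max (wf α r / Q) 1 (wf α r' / Q') 1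
    have e : wf α r / Q - wf α r' / Q' =
        (wf α r - wf α r') / Q + wf α r' * (Q' - Q) / (Q * Q') := by field_simp; ring
    have s2 : |(wf α r - wf α r') / Q| ≤ (2 * α⁻¹ * A / r0 * Δ) / c := by
      rw [abs_div, abs_of_pos hQ0]; gcongr
    have s3 : |wf α r' * (Q' - Q) / (Q * Q')| ≤ A * (2 / c * Δ) / (c * c) := by
      rw [abs_div, abs_mul, abs_of_pos hw', abs_of_pos (mul_pos hQ0 hQ0'), abs_sub_comm Q' Q]
      gcongr
    have s4 : A * (2 / c * Δ) / (c * c) ≤ (2 / c^3) * A / r0 * Δ := by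
      have : A * (2 / c * Δ) / (c * c) = (2 / c^3) * A / 1 * Δ := by field_simp
      rw [this]; gcongr
    rw [e] at s1
    calc |β - β'| ≤ (2 * α⁻¹ * A / r0 * Δ) / c + (2 / c^3) * A / r0 * Δ := by
          refine s1.trans ((abs_add_le _ _).trans ?_); linarith
      _ = _ := by rw [hC1]; field_simp
  have gl : |β / r - β' / r'| ≤ (2 * C1 + 4 / c) * A / r0^2 * Δ := by
    have e : β / r - β' / r' = (β - β') / r + β' * (r' - r) / (r * r') := by field_simp; ring
    rw [e]
    have s2 : |(β - β') / r| ≤ (C1 * A / r0 * Δ) / (r0 / 2) := by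
      rw [abs_div, abs_of_pos hr0]; gcongr
    have s3 : |β' * (r' - r) / (r * r')| ≤ (A / c) * Δ / ((r0 / 2) * (r0 / 2)) := by
      rw [abs_div, abs_mul, abs_of_pos hβ0', abs_of_pos (mul_pos hr0 hr0'), abs_sub_comm r' r]
      gcongr
    calc _ ≤ (C1 * A / r0 * Δ) / (r0 / 2) + (A / c) * Δ / ((r0 / 2) * (r0 / 2)) :=
          (abs_add_le _ _).trans (add_le_add s2 s3)
      _ = _ := by field_simp; ring
  have hγ' : β' / r' ≤ 2 * A / (c * r0) := by
    calc β' / r' ≤ (A / c) / (r0 / 2) := by gcongr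
      _ = _ := by field_simp
  have hm := mf_lip hr0.le hr1 hr0'.le hr1'
  set z := max (T - mf r) 0 with hz
  set z' := max (T' - mf r') 0 with hz'
  have zl : |z - z'| ≤ |T - T'| + 3 * Δ := by
    have : |z - z'| ≤ |(T - mf r) - (T' - mf r')| := by
      simpa using abs_max_sub_max_le_max (T - mf r) 0 (T' - mf r') 0
    refine this.trans ?_
    rw [show (T - mf r) - (T' - mf r') = (T - T') - (mf r - mf r') by ring]
    exact (abs_sub _ _).trans (by linarith)
  have hz0 : 0 ≤ z := le_max_right _ _
  have hzr : z ≤ 2 * r0 := by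
    apply max_le _ (by linarith)
    have := (abs_lt.1 (lt_qf hr0.le hT)).2
    have := qf_le_one hr0.le hr1
    unfold mf; nlinarith
  have e : z * (β / r) - z' * (β' / r') = z * (β / r - β' / r') + (β' / r') * (z - z') := by ring
  rw [e]
  have s1 : |z * (β / r - β' / r')| ≤ 2 * r0 * ((2 * C1 + 4 / c) * A / r0^2 * Δ) := by
    rw [abs_mul, abs_of_nonneg hz0]; gcongr
  have s2 : |(β' / r') * (z - z')| ≤ 2 * A / (c * r0) * (|T - T'| + 3 * Δ) := by
    rw [abs_mul, abs_of_pos (by positivity)]; gcongr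
  calc _ ≤ 2 * r0 * ((2 * C1 + 4 / c) * A / r0^2 * Δ) + 2 * A / (c * r0) * (|T - T'| + 3 * Δ) :=
        (abs_add_le _ _).trans (add_le_add s1 s2)
    _ ≤ 2 * r0 * ((2 * C1 + 4 / c) * A / r0^2 * (|T - T'| + Δ))
        + 2 * A / (c * r0) * (3 * (|T - T'| + Δ)) := by
        have := abs_nonneg (T - T')
        gcongr
        · linarith
        · linarith
    _ = _ := by rw [hA]; field_simp; ring

end



def jac {n : ℕ} (h : Euc n → Euc n) (x : Euc n) : Matrix (Fin n) (Fin n) ℝ :=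
  Matrix.of fun i j => fderiv ℝ h x (EuclideanSpace.single j 1) i

lemma opNorm_jac {n : ℕ} (h : Euc n → Euc n) (x : Euc n) : opNorm (jac h x) = ‖fderiv ℝ h x‖ := by
  unfold opNorm
  congr 1
  apply ContinuousLinearMap.coe_injective
  apply (EuclideanSpace.basisFun (Fin n) ℝ).toBasis.ext
  intro j
  ext i
  simp [jac, Matrix.toEuclideanLin]

lemma abs_jac_le {n : ℕ} (h : Euc n → Euc n) (x : Euc n) (i j : Fin n) :
    |jac h x i j| ≤ ‖fderiv ℝ h x‖ := by
  have h1 : |jac h x i j| ≤ ‖fderiv ℝ h x (EuclideanSpace.single j 1)‖ := by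
    have := EuclideanSpace.norm_eq (fderiv ℝ h x (EuclideanSpace.single j 1))
    simpa [jac] using PiLp.norm_apply_le (fderiv ℝ h x (EuclideanSpace.single j 1)) i
  refine h1.trans (((fderiv ℝ h x).le_opNorm _).trans (le_of_eq ?_))
  simp

lemma measurable_jac {n : ℕ} (h : Euc n → Euc n) (i j : Fin n) :
    Measurable (fun x => jac h x i j) := by
  have := measurable_fderiv_apply_const ℝ h (EuclideanSpace.single j (1:ℝ))
  have h2 : Measurable (fun v : Euc n => v i) := (EuclideanSpace.proj (𝕜 := ℝ) i).continuous.measurable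
  exact h2.comp this

lemma locLip_parts {n : ℕ} {Ω : Set (Euc n)} {h : Euc n → Euc n}
    (hL : LocallyLipschitzOn Ω h) (φ : Euc n → ℝ)
    (hφ : ContDiff ℝ ((⊤ : ℕ∞) : WithTop ℕ∞) φ) (hc : HasCompactSupport φ)
    (hs : tsupport φ ⊆ Ω) (i j : Fin n) :
      ∫ x in Ω, h x i * fderiv ℝ φ x (EuclideanSpace.single j 1) =
        - ∫ x in Ω, jac h x i j * φ x := by
  set v : Euc n := EuclideanSpace.single j 1
  obtain ⟨K, hK⟩ := (hL.mono hs).exists_lipschitzOnWith_of_compact hc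
  have hKi : LipschitzOnWith K (fun x => h x i) (tsupport φ) := by
    refine LipschitzOnWith.of_dist_le_mul fun x hx y hy => ?_
    refine le_trans ?_ (hK.dist_le_mul x hx y hy)
    rw [dist_eq_norm, dist_eq_norm]
    exact PiLp.norm_apply_le (h x - h y) i
  obtain ⟨g, hg, hgeq⟩ := hKi.extend_real
  obtain ⟨D, hD⟩ := hφ.lipschitzWith_of_hasCompactSupport hc (by simp)
  have main := LipschitzWith.integral_lineDeriv_mul_eq (μ := volume) hg hD hc v
  have zero1 : ∀ x, x ∉ tsupport φ → φ x = 0 := fun x hx => image_eq_zero_of_notMem_tsupport hx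
  have zero2 : ∀ x, x ∉ tsupport φ → fderiv ℝ φ x = 0 := fun x hx => by
    by_contra hne
    exact hx (support_fderiv_subset ℝ hne)
  rw [setIntegral_eq_integral_of_forall_compl_eq_zero, setIntegral_eq_integral_of_forall_compl_eq_zero]
  · have e1 : ∫ x, h x i * fderiv ℝ φ x v = - ∫ x, lineDeriv ℝ φ x (-v) * g x := by
      rw [← integral_neg]
      apply integral_congr_ae
      filter_upwards with x
      have hd : DifferentiableAt ℝ φ x := (hφ.differentiable (by simp)) x
      rw [lineDeriv_neg, hd.lineDeriv_eq_fderiv]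
      by_cases hx : x ∈ tsupport φ
      · rw [← hgeq hx]; ring
      · rw [zero2 x hx]; simp
    rw [e1, ← main]
    congr 1
    apply integral_congr_ae
    filter_upwards [hK.ae_differentiableWithinAt_of_mem (μ := volume)] with x hx
    by_cases h0 : φ x = 0
    · simp [h0]
    have hop : IsOpen {y | φ y ≠ 0} := isOpen_ne_fun hφ.continuous continuous_const
    have hsub : {y | φ y ≠ 0} ⊆ tsupport φ := subset_tsupport φ
    have hn : tsupport φ ∈ nhds x := Filter.mem_of_superset (hop.mem_nhds h0) hsub
    have hdiff : DifferentiableAt ℝ h x := (hx (mem_of_mem_nhds hn)).differentiableAt hn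
    congr 1
    have hev : g =ᶠ[nhds x] fun y => h y i := by
      filter_upwards [hn] with y hy using (hgeq hy).symm
    rw [hev.lineDeriv_eq]
    have hp := ((EuclideanSpace.proj (𝕜 := ℝ) i).hasFDerivAt (x := h x)).comp x hdiff.hasFDerivAt
    have : HasLineDerivAt ℝ (fun y => h y i) _ x v := hp.hasLineDerivAt v
    rw [this.lineDeriv]
    rfl
  · intro x hx
    rw [zero1 x (fun h => hx (hs h)), mul_zero]
  · intro x hx
    rw [zero2 x (fun h => hx (hs h))]; simp

lemma memSobolev_of_locLip {n : ℕ} (h : Euc n → Euc n) (ρ : Euc n → ℝ) (hρ0 : ∀ x, 0 ≤ ρ x)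
    (hloc : ∀ p ∈ unitBall n, ∃ s ∈ nhds p, LipschitzOnWith (ρ p).toNNReal h s)
    (hρ : IntegrableOn (fun x => ρ x ^ n) (unitBall n) volume) :
    LocallyLipschitzOn (unitBall n) h ∧ MemSobolev (n : ℝ) (unitBall n) h (jac h) := by
  have hopen : IsOpen (unitBall n) := isOpen_ball
  have hL : LocallyLipschitzOn (unitBall n) h := by
    intro p hp
    obtain ⟨s, hs, hl⟩ := hloc p hp
    exact ⟨_, s, mem_nhdsWithin_of_mem_nhds hs, hl⟩
  refine ⟨hL, ?_, ?_, fun φ h1 h2 h3 i j => locLip_parts hL φ h1 h2 h3 i j, ?_⟩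
  · intro i
    have hc : ContinuousOn (fun x => h x i) (unitBall n) :=
      (EuclideanSpace.proj (𝕜 := ℝ) i).continuous.comp_continuousOn hL.continuousOn
    exact hc.locallyIntegrableOn hopen.measurableSet
  · intro i j p hp
    obtain ⟨s, hs, hl⟩ := hloc p hp
    obtain ⟨ε, hε, hsub⟩ := Metric.mem_nhds_iff.1 hs
    refine ⟨ball p ε, mem_nhdsWithin_of_mem_nhds (ball_mem_nhds p hε), ?_⟩
    refine Measure.integrableOn_of_bounded (M := ((ρ p).toNNReal : ℝ)) measure_ball_lt_top.ne
      (measurable_jac h i j).aestronglyMeasurable ?_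
    rw [ae_restrict_iff' measurableSet_ball]
    filter_upwards with x hx
    refine (abs_jac_le h x i j).trans ?_
    exact norm_fderiv_le_of_lipschitzOn ℝ (Filter.mem_of_superset (isOpen_ball.mem_nhds hx) hsub) hl
  · refine hρ.mono' ?_ ?_
    · simp_rw [opNorm_jac, Real.rpow_natCast]
      exact ((measurable_fderiv ℝ h).norm.pow_const n).aestronglyMeasurable
    · rw [ae_restrict_iff' hopen.measurableSet]
      filter_upwards with x hx
      obtain ⟨s, hs, hl⟩ := hloc x hx
      have := norm_fderiv_le_of_lipschitzOn ℝ hs hl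
      rw [Real.coe_toNNReal _ (hρ0 x)] at this
      rw [opNorm_jac, Real.rpow_natCast, Real.norm_of_nonneg (by positivity)]
      gcongr


/-- radial majorant near the pole -/
def Gf (α s : ℝ) : ℝ := if 0 < s ∧ s < 1 then wf α s / s else 0

lemma Gf_nonneg (α s : ℝ) : 0 ≤ Gf α s := by
  unfold Gf; split_ifs with h
  · have := wf_pos α h.1 h.2.le
    have := h.1
    positivity
  · exact le_rfl

lemma oneD_int {κ : ℝ} (hκ : 1 < κ) :
    IntegrableOn (fun r : ℝ => (1 - Real.log r) ^ (-κ) / r) (Ioc 0 1) := by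
  set g : ℝ → ℝ := fun r => if r = 0 then 0 else (1 - Real.log r) ^ (1 - κ) / (κ - 1)
  have hder : ∀ x ∈ Ioo (0:ℝ) 1, HasDerivAt g ((1 - Real.log x) ^ (-κ) / x) x := by
    intro x hx
    have hL := L_one_le hx.1 hx.2.le
    have := (((Real.hasDerivAt_log hx.1.ne').const_sub 1).rpow_const (p := 1 - κ)
      (Or.inl (by linarith))).div_const (κ - 1)
    have hev : g =ᶠ[nhds x] fun r => (1 - Real.log r) ^ (1 - κ) / (κ - 1) := by
      filter_upwards [isOpen_ne.mem_nhds hx.1.ne'] with y hy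
      simp only [g, if_neg hy]
    refine (this.congr_of_eventuallyEq hev).congr_deriv ?_
    rw [show 1 - κ - 1 = -κ by ring]
    field_simp [show κ - 1 ≠ 0 by linarith, hx.1.ne']
    ring
  refine intervalIntegral.integrableOn_deriv_of_nonneg (g := g) ?_ hder ?_
  · intro x hx
    rcases hx.1.eq_or_lt with h | h
    · subst h
      have h1 : Filter.Tendsto (fun r : ℝ => 1 - Real.log r) (nhdsWithin 0 (Ioi 0)) Filter.atTop :=
        Filter.tendsto_atTop_add_const_left _ _
          (Filter.tendsto_neg_atBot_atTop.comp Real.tendsto_log_nhdsGT_zero)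
      have h2 : Filter.Tendsto (fun r : ℝ => (1 - Real.log r) ^ (1 - κ) / (κ - 1))
          (nhdsWithin 0 (Ioi 0)) (nhds 0) := by
        have := ((tendsto_rpow_neg_atTop (y := κ - 1) (by linarith)).comp h1).div_const (κ - 1)
        simpa [Function.comp_def] using this
      have h3 : Filter.Tendsto g (nhdsWithin 0 (Ioi 0)) (nhds (g 0)) := by
        have : g 0 = 0 := by simp [g]
        rw [this]
        refine h2.congr' ?_
        filter_upwards [self_mem_nhdsWithin] with y hy
        have hy' : y ≠ 0 := ne_of_gt (Set.mem_Ioi.1 hy)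
        simp only [g, if_neg hy']
      have h4 : ContinuousWithinAt g (Ioi 0) 0 := h3
      have h5 : ContinuousWithinAt g (Ici 0) 0 := by
        rw [← continuousWithinAt_Ioi_iff_Ici]; exact h4
      exact h5.mono Icc_subset_Ici_self
    · have hL := L_one_le h hx.2
      have hc : ContinuousAt (fun r => (1 - Real.log r) ^ (1 - κ) / (κ - 1)) x :=
        (((Real.continuousAt_log h.ne').const_sub 1).rpow_const (Or.inl (by linarith))).div_const _
      have hev : g =ᶠ[nhds x] fun r => (1 - Real.log r) ^ (1 - κ) / (κ - 1) := by
        filter_upwards [isOpen_ne.mem_nhds h.ne'] with y hy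
        simp only [g, if_neg hy]
      exact (hc.congr hev.symm).continuousWithinAt
  · intro x hx
    have hL := L_one_le hx.1 hx.2.le
    have := hx.1
    have : (0:ℝ) < 1 - Real.log x := by linarith
    positivity

lemma Gf_int {n : ℕ} (hn : 2 ≤ n) {α : ℝ} (ha : 0 < α) (hα : α < n) :
    Integrable (fun x : Euc n => Gf α ‖x‖ ^ n) volume := by
  have : Nonempty (Fin n) := ⟨⟨0, by omega⟩⟩
  rw [integrable_fun_norm_addHaar (μ := (volume : Measure (Euc n))) (f := fun s => Gf α s ^ n)]
  have hκ : 1 < (n:ℝ) / α := by rwa [one_lt_div ha]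
  have h1 : IntegrableOn (fun y : ℝ => y ^ (Module.finrank ℝ (Euc n) - 1) • Gf α y ^ n) (Ioo 0 1) := by
    refine ((oneD_int hκ).mono_set Ioo_subset_Ioc_self).congr_fun ?_ measurableSet_Ioo
    intro y hy
    have hL := L_one_le hy.1 hy.2.le
    have hy0 := hy.1
    simp only [finrank_euclideanSpace, Fintype.card_fin, smul_eq_mul]
    rw [Gf, if_pos ⟨hy.1, hy.2⟩, div_pow, wf, ← Real.rpow_natCast ((1 - Real.log y) ^ (-α⁻¹)) n, ← Real.rpow_mul (by linarith)]
    rw [show -α⁻¹ * (n:ℝ) = -(n / α) by field_simp]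
    obtain ⟨k, rfl⟩ : ∃ k, n = k + 1 := ⟨n - 1, by omega⟩
    rw [Nat.add_sub_cancel, pow_succ]
    field_simp
  have h2 : IntegrableOn (fun y : ℝ => y ^ (Module.finrank ℝ (Euc n) - 1) • Gf α y ^ n) (Ici 1) := by
    refine (integrableOn_zero).congr_fun ?_ measurableSet_Ici
    intro y hy
    have : ¬ (0 < y ∧ y < 1) := fun h => absurd h.2 (not_lt.2 hy)
    simp [Gf, this, show n ≠ 0 by omega]
  have := h1.union h2
  rwa [Ioo_union_Ici_eq_Ioi zero_lt_one] at this

lemma Gf_meas (α : ℝ) : Measurable (Gf α) := by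
  unfold Gf wf
  refine Measurable.ite ?_ (by fun_prop) measurable_const
  exact measurableSet_Ioo

lemma rho_int {n : ℕ} (hn : 2 ≤ n) {α : ℝ} (ha : 0 < α) (hα : α < n) (e : Euc n) {A B : ℝ}
    (hA : 0 ≤ A) (hB : 0 ≤ B) :
    IntegrableOn (fun x : Euc n => (A + B * Gf α ‖x - e‖) ^ n) (unitBall n) volume := by
  have h1 : Integrable (fun x : Euc n => Gf α ‖x - e‖ ^ n) volume :=
    (Gf_int hn ha hα).comp_sub_right e
  have hfin : volume (unitBall n) ≠ ⊤ := measure_ball_lt_top.ne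
  have h2 : IntegrableOn (fun x : Euc n => 2 ^ (n - 1) * (A ^ n + B ^ n * Gf α ‖x - e‖ ^ n))
      (unitBall n) volume :=
    (Integrable.add (integrableOn_const hfin) (h1.integrableOn.const_mul (B ^ n))).const_mul _
  refine h2.mono' ?_ ?_
  · have := (Gf_meas α).comp ((measurable_id.sub_const e).norm)
    have h3 : Measurable (fun x : Euc n => (A + B * Gf α ‖x - e‖) ^ n) :=
      ((this.const_mul B).const_add A).pow_const n
    exact h3.aestronglyMeasurable
  · filter_upwards with x
    have := Gf_nonneg α ‖x - e‖
    rw [Real.norm_of_nonneg (by positivity), ← mul_pow]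
    exact add_pow_le hA (by positivity) n


lemma le_of_sq' {a b : ℝ} (h : a ^ 2 ≤ b ^ 2) (hb : 0 ≤ b) : a ≤ b := (abs_le_of_sq_le_sq' h hb).2

def ax (n : ℕ) [NeZero n] : Euc n := EuclideanSpace.single 0 1

def rr {n : ℕ} [NeZero n] (p : Euc n) : ℝ := Real.sqrt (∑ i ∈ Finset.univ.erase (0 : Fin n), p i ^ 2)

lemma rr_nonneg {n : ℕ} [NeZero n] (p : Euc n) : 0 ≤ rr p := Real.sqrt_nonneg _

lemma norm_sq_rr {n : ℕ} [NeZero n] (p : Euc n) : ‖p‖ ^ 2 = p 0 ^ 2 + rr p ^ 2 := by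
  rw [rr, Real.sq_sqrt (Finset.sum_nonneg fun i _ => sq_nonneg _), EuclideanSpace.real_norm_sq_eq,
    Finset.add_sum_erase _ (fun i => p i ^ 2) (Finset.mem_univ 0)]

lemma ax_zero {n : ℕ} [NeZero n] : ax n 0 = 1 := by simp [ax]
lemma ax_ne {n : ℕ} [NeZero n] {i : Fin n} (h : i ≠ 0) : ax n i = 0 := by simp [ax, h]
lemma norm_ax {n : ℕ} [NeZero n] : ‖ax n‖ = 1 := by simp [ax]

lemma rr_add {n : ℕ} [NeZero n] (p : Euc n) (c : ℝ) : rr (p + c • ax n) = rr p := by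
  unfold rr
  congr 1
  apply Finset.sum_congr rfl
  intro i hi
  simp [ax_ne (Finset.ne_of_mem_erase hi)]

lemma rr_eq_norm {n : ℕ} [NeZero n] (p : Euc n) : rr p = ‖p + (-p 0) • ax n‖ := by
  have h := norm_sq_rr (p + (-p 0) • ax n)
  rw [rr_add] at h
  have h0 : (p + (-p 0) • ax n) 0 = 0 := by simp [ax_zero]
  rw [h0] at h
  have h2 : rr p ^ 2 = ‖p + (-p 0) • ax n‖ ^ 2 := by rw [h]; ring
  exact (pow_left_inj₀ (rr_nonneg p) (norm_nonneg _) two_ne_zero).1 h2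

lemma abs_coord {n : ℕ} (p p' : Euc n) (i : Fin n) : |p i - p' i| ≤ ‖p - p'‖ := by
  simpa using PiLp.norm_apply_le (p - p') i

lemma rr_lip {n : ℕ} [NeZero n] (p p' : Euc n) : |rr p - rr p'| ≤ 2 * ‖p - p'‖ := by
  rw [rr_eq_norm, rr_eq_norm]
  refine (abs_norm_sub_norm_le _ _).trans ?_
  have e : p + (-p 0) • ax n - (p' + (-p' 0) • ax n) = (p - p') + (p' 0 - p 0) • ax n := by
    module
  rw [e]
  refine (norm_add_le _ _).trans ?_
  rw [norm_smul, norm_ax, Real.norm_eq_abs, abs_sub_comm]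
  linarith [abs_coord p p' 0]

lemma rr_cont {n : ℕ} [NeZero n] : Continuous (rr : Euc n → ℝ) := by
  unfold rr; fun_prop

lemma mem_unitBall {n : ℕ} [NeZero n] (p : Euc n) : p ∈ unitBall n ↔ p 0 ^ 2 + rr p ^ 2 < 1 := by
  rw [← norm_sq_rr, unitBall, mem_ball_zero_iff, sq_lt_one_iff₀ (norm_nonneg _)]

lemma cusp_iff {α t r : ℝ} (ha : 0 < α) (ht : 0 < t) (hr : 0 < r) (hr1 : r < 1) :
    cuspFun α t < r ↔ t < wf α r := by
  have hL := L_one_le hr hr1.le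
  rw [cuspFun, if_pos ht, ← Real.exp_sub, ← Real.lt_log_iff_exp_lt hr]
  have e : wf α r = ((1 - Real.log r) ^ α⁻¹)⁻¹ := by
    rw [wf, Real.rpow_neg (by linarith)]
  have hp : 0 < (1 - Real.log r) ^ α⁻¹ := Real.rpow_pos_of_pos (by linarith) _
  rw [e, lt_inv_comm₀ ht hp, Real.rpow_inv_lt_iff_of_pos (by linarith) (by positivity) ha,
    Real.inv_rpow ht.le, ← Real.rpow_neg ht.le]
  constructor <;> intro h <;> linarith

lemma mem_cuspBall {n : ℕ} [NeZero n] {α : ℝ} (ha : 0 < α) (p : Euc n) :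
    p ∈ cuspBall n (cuspFun α) ↔ InC α (p 0) (rr p) := by
  have hb := mem_unitBall p
  have h0 := rr_nonneg p
  have : p ∈ cuspBall n (cuspFun α) ↔ p ∈ unitBall n ∧ (0 ≤ p 0 → cuspFun α (p 0) < rr p) := by
    unfold cuspBall unitBall rr
    simp only [mem_sdiff, mem_ofPred_eq, not_and, not_le]
  rw [this, hb, InC]
  constructor
  · rintro ⟨h1, h2⟩
    refine ⟨h0, h1, fun ht => ?_⟩
    have h3 := h2 ht
    have hr1 := ball_lt_one h0 h1
    rcases ht.eq_or_lt with ht0 | ht0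
    · rw [← ht0] at h3 ⊢
      simp [cuspFun] at h3
      exact ⟨h3, wf_pos α h3 hr1.le⟩
    · have hr : 0 < rr p := by
        refine lt_trans ?_ h3
        rw [cuspFun, if_pos ht0]; positivity
      exact ⟨hr, (cusp_iff ha ht0 hr hr1).1 h3⟩
  · rintro ⟨-, h1, h2⟩
    refine ⟨h1, fun ht => ?_⟩
    obtain ⟨hr, h3⟩ := h2 ht
    have hr1 := ball_lt_one h0 h1
    rcases ht.eq_or_lt with ht0 | ht0
    · rw [← ht0]; simpa [cuspFun] using hr
    · exact (cusp_iff ha ht0 hr hr1).2 h3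

/-- change only the first coordinate -/
def lift1 {n : ℕ} [NeZero n] (Φ : ℝ → ℝ → ℝ) (p : Euc n) : Euc n :=
  p + (Φ (p 0) (rr p) - p 0) • ax n

lemma lift1_zero {n : ℕ} [NeZero n] (Φ : ℝ → ℝ → ℝ) (p : Euc n) :
    lift1 Φ p 0 = Φ (p 0) (rr p) := by
  simp [lift1, ax_zero]

lemma lift1_rr {n : ℕ} [NeZero n] (Φ : ℝ → ℝ → ℝ) (p : Euc n) : rr (lift1 Φ p) = rr p :=
  rr_add _ _

lemma lift1_lift1 {n : ℕ} [NeZero n] (Φ Ψ : ℝ → ℝ → ℝ) (p : Euc n)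
    (h : Φ (Ψ (p 0) (rr p)) (rr p) = p 0) : lift1 Φ (lift1 Ψ p) = p := by
  rw [lift1, lift1_rr, lift1_zero, h, lift1]
  module

lemma lift1_dist {n : ℕ} [NeZero n] (Φ : ℝ → ℝ → ℝ) (p p' : Euc n) {M : ℝ} (hM : 0 ≤ M)
    (h : |Φ (p 0) (rr p) - Φ (p' 0) (rr p')| ≤ M * (|p 0 - p' 0| + |rr p - rr p'|)) :
    ‖lift1 Φ p - lift1 Φ p'‖ ≤ (2 + 3 * M) * ‖p - p'‖ := by
  have e : lift1 Φ p - lift1 Φ p' = (p - p') +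
      ((Φ (p 0) (rr p) - Φ (p' 0) (rr p')) - (p 0 - p' 0)) • ax n := by
    unfold lift1; module
  rw [e]
  refine (norm_add_le _ _).trans ?_
  rw [norm_smul, norm_ax, Real.norm_eq_abs, mul_one]
  have h1 := abs_sub (Φ (p 0) (rr p) - Φ (p' 0) (rr p')) (p 0 - p' 0)
  have h2 := abs_coord p p' 0
  have h3 := rr_lip p p'
  nlinarith

lemma lift1_lipOn {n : ℕ} [NeZero n] (Φ : ℝ → ℝ → ℝ) (s : Set (Euc n)) {M R : ℝ} (hM : 0 ≤ M)
    (hR : 2 + 3 * M ≤ R)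
    (h : ∀ p ∈ s, ∀ p' ∈ s, |Φ (p 0) (rr p) - Φ (p' 0) (rr p')| ≤
      M * (|p 0 - p' 0| + |rr p - rr p'|)) :
    LipschitzOnWith R.toNNReal (lift1 Φ) s := by
  refine LipschitzOnWith.of_dist_le_mul fun p hp p' hp' => ?_
  rw [dist_eq_norm, dist_eq_norm, Real.coe_toNNReal _ (by linarith)]
  refine (lift1_dist Φ p p' hM (h p hp p' hp')).trans ?_
  gcongr

lemma wr_le_Gf {n : ℕ} [NeZero n] {α : ℝ} (ha : 0 < α) (p : Euc n) (hp : p ∈ unitBall n)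
    (hm : mf (rr p) ≤ p 0) : wf α (rr p) / rr p ≤ 3 + 3 * Gf α ‖p - ax n‖ := by
  rw [mem_unitBall] at hp
  have hr := pos_of_mf_le (rr_nonneg p) hp hm
  have hr1 := ball_lt_one hr.le hp
  have hw := wf_pos α hr hr1.le
  have hw1 := wf_le_one ha hr hr1.le
  set s := ‖p - ax n‖ with hs
  have hs0 : 0 ≤ s := norm_nonneg _
  have hs2 : s ^ 2 = (p 0 - 1) ^ 2 + rr p ^ 2 := by
    rw [hs, norm_sq_rr]
    have : p - ax n = p + (-1 : ℝ) • ax n := by module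
    rw [this, rr_add]
    congr 2
    simp [ax_zero, sub_eq_add_neg]
  set r := rr p
  have hT1 : p 0 < 1 := by nlinarith
  have hT : 1 - 2 * r ≤ p 0 := by
    have hq := qf_sq hr.le hr1
    have : 1 - r ≤ qf r := by
      refine le_of_sq' ?_ (qf_nonneg r)
      rw [hq]; nlinarith
    unfold mf at hm; nlinarith
  have hsr : s ≤ 3 * r := by
    refine le_of_sq' ?_ (by linarith)
    rw [hs2]; nlinarith
  have hrs : r ≤ s := by
    refine le_of_sq' ?_ hs0
    rw [hs2]; nlinarith [sq_nonneg (p 0 - 1)]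
  have hG := Gf_nonneg α s
  rcases lt_or_ge s 1 with h | h
  · have hsp : 0 < s := hr.trans_le hrs
    have hws := wf_mono ha hr hrs h.le
    have : Gf α s = wf α s / s := by rw [Gf, if_pos ⟨hsp, h⟩]
    rw [this]
    have : wf α r / r ≤ wf α s / (s / 3) := by
      have := wf_pos α hsp h.le
      gcongr
      linarith
    have e : wf α s / (s / 3) = 3 * (wf α s / s) := by field_simp
    linarith
  · have : wf α r / r ≤ 1 / (1 / 3) := by
      gcongr
      linarith
    norm_num at this
    linarith

lemma h_loc {n : ℕ} [NeZero n] {α : ℝ} (ha : 0 < α) : ∃ A B : ℝ, 0 ≤ A ∧ 0 ≤ B ∧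
    ∀ p ∈ unitBall n, ∃ s ∈ nhds p,
      LipschitzOnWith (A + B * Gf α ‖p - ax n‖).toNNReal (lift1 (cH α)) s := by
  obtain ⟨C, hC, hup⟩ := up_lip ha
  refine ⟨2 + 3 * (5 + C * 3), 3 * (C * 3), by positivity, by positivity, fun p hp => ?_⟩
  have hopen : IsOpen (unitBall n) := isOpen_ball
  have hG := Gf_nonneg α ‖p - ax n‖
  have hCG := mul_nonneg hC hG
  rcases lt_or_ge (p 0) (mf (rr p)) with hz | hz
  · have hmc : Continuous (fun p : Euc n => mf (rr p)) := by
      have := rr_cont (n := n)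
      unfold mf qf; fun_prop
    have hop : IsOpen {p : Euc n | p 0 < mf (rr p)} := isOpen_lt (by fun_prop) hmc
    refine ⟨unitBall n ∩ {p : Euc n | p 0 < mf (rr p)}, (hopen.inter hop).mem_nhds ⟨hp, hz⟩, ?_⟩
    refine lift1_lipOn _ _ (M := 5) (by norm_num) (by nlinarith) ?_
    rintro x ⟨hx, hx'⟩ y ⟨hy, hy'⟩
    rw [mem_unitBall] at hx hy
    have := low_lip (rr_nonneg x) hx (rr_nonneg y) hy
    simp only [mem_ofPred_eq] at hx' hy'
    rw [cH_neg hx'.le, cH_neg hy'.le]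
    rwa [min_eq_left (by linarith), min_eq_left (by linarith)] at this
  · have hw := wr_le_Gf ha p hp hz
    have hp' := (mem_unitBall p).1 hp
    have hr := pos_of_mf_le (rr_nonneg p) hp' hz
    have hr1 := ball_lt_one hr.le hp'
    have hw0 := wf_pos α hr hr1.le
    have hop : IsOpen {x : Euc n | rr p / 2 < rr x ∧ rr x < 2 * rr p} :=
      (isOpen_lt continuous_const rr_cont).inter (isOpen_lt rr_cont continuous_const)
    refine ⟨unitBall n ∩ {x : Euc n | rr p / 2 < rr x ∧ rr x < 2 * rr p},
      (hopen.inter hop).mem_nhds ⟨hp, by constructor <;> linarith⟩, ?_⟩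
    refine lift1_lipOn _ _ (M := 5 + C * (wf α (rr p) / rr p)) (by positivity) (by nlinarith) ?_
    rintro x ⟨hx, hx1, hx2⟩ y ⟨hy, hy1, hy2⟩
    rw [mem_unitBall] at hx hy
    have l := low_lip (rr_nonneg x) hx (rr_nonneg y) hy
    have u := hup (rr p) hr hr1 _ _ _ _ hx1 hx2 hy1 hy2 hx hy
    rw [add_mul]
    refine le_trans ?_ (add_le_add l u)
    refine le_trans (le_of_eq ?_) (abs_add_le _ _)
    congr 1
    unfold cH; ring

/-- For `n ≥ 2`, `0 < α < n` and `u(t) = e / exp(t^{−α})`, there is a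
homeomorphism `h : 𝔹 → 𝔹_u` of finite conformal energy whose inverse is Lipschitz. -/
theorem stmt_10 {n : ℕ} [NeZero n] (hn : 2 ≤ n) (α : ℝ) (hα0 : 0 < α) (hα : α < n) :
    ∃ h f : Euc n → Euc n,
      IsHomeoOn h f (unitBall n) (cuspBall n (cuspFun α)) ∧
      (∃ Dh, MemSobolev (n : ℝ) (unitBall n) h Dh) ∧
      (∃ L : ℝ≥0, LipschitzOnWith L f (cuspBall n (cuspFun α))) := by
  obtain ⟨A, B, hA, hB, hloc⟩ := h_loc (n := n) hα0
  have hsob := memSobolev_of_locLip (lift1 (cH α)) (fun p => A + B * Gf α ‖p - ax n‖)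
    (fun x => add_nonneg hA (mul_nonneg hB (Gf_nonneg _ _))) hloc (rho_int hn hα0 hα (ax n) hA hB)
  obtain ⟨C, hC, hF⟩ := cF_lip hα0
  have hLip : LipschitzOnWith (2 + 3 * C).toNNReal (lift1 (cF α)) (cuspBall n (cuspFun α)) := by
    refine lift1_lipOn _ _ hC le_rfl fun p hp p' hp' => ?_
    rw [mem_cuspBall hα0] at hp hp'
    exact hF _ _ _ _ hp hp'
  refine ⟨lift1 (cH α), lift1 (cF α), ⟨?_, ?_, ?_, ?_, hsob.1.continuousOn, hLip.continuousOn⟩,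
    ⟨_, hsob.2⟩, ⟨_, hLip⟩⟩
  · intro p hp
    rw [mem_cuspBall hα0, lift1_zero, lift1_rr]
    exact cH_mem (rr_nonneg p) ((mem_unitBall p).1 hp)
  · intro p hp
    rw [mem_unitBall, lift1_zero, lift1_rr]
    exact cF_mem ((mem_cuspBall hα0 p).1 hp)
  · intro p hp
    exact lift1_lift1 _ _ p (cF_cH (rr_nonneg p) ((mem_unitBall p).1 hp))
  · intro p hp
    exact lift1_lift1 _ _ p (cH_cF ((mem_cuspBall hα0 p).1 hp))
end
end

section
/- Let n ≥ 3, let 𝔹_u be a model inward-cusp ball, and let h : 𝔹 → 𝔹_u be a homeomorphism in the Sobolev class W^{1,n}(𝔹, ℝⁿ). Suppose H : cl(𝔹) → cl(𝔹_u) is a continuous extension of h. Then for every y ∈ ∂𝔹_u the preimage H⁻¹(y) is a nonempty compact connected subset of ∂𝔹. -/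
open MeasureTheory Metric Set
open scoped ENNReal NNReal

noncomputable section

/-- The radial part `|x|` of `p = (t, x)`. -/
def cuspRho {n : ℕ} [NeZero n] (p : Euc n) : ℝ :=
  Real.sqrt (∑ i ∈ Finset.univ.erase (0 : Fin n), p i ^ 2)

/-- The closed cusp. -/
def cuspSet (n : ℕ) [NeZero n] (u : ℝ → ℝ) : Set (Euc n) :=
  {p | 0 ≤ p 0 ∧ cuspRho p ≤ u (p 0)}

lemma cuspBall_eq (n : ℕ) [NeZero n] (u : ℝ → ℝ) :
    cuspBall n u = Metric.ball 0 1 \ cuspSet n u := rfl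

lemma cuspRho_continuous {n : ℕ} [NeZero n] : Continuous (cuspRho : Euc n → ℝ) := by
  unfold cuspRho
  fun_prop

lemma cusp_v_continuous {u : ℝ → ℝ} (hu : IsModelCusp u) :
    Continuous (fun t : ℝ => u (max t 0)) := by
  apply hu.continuousOn.comp_continuous (by fun_prop)
  intro t
  exact le_max_right t 0

lemma cuspSet_closed {n : ℕ} [NeZero n] {u : ℝ → ℝ} (hu : IsModelCusp u) :
    IsClosed (cuspSet n u) := by
  have : cuspSet n u = {p | 0 ≤ p 0} ∩ {p | cuspRho p ≤ u (max (p 0) 0)} := by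
    ext p
    simp only [cuspSet, mem_setOf_eq, mem_inter_iff]
    constructor
    · rintro ⟨a, b⟩
      exact ⟨a, by rwa [max_eq_left a]⟩
    · rintro ⟨a, b⟩
      exact ⟨a, by rwa [max_eq_left a] at b⟩
  rw [this]
  have hc : Continuous (fun p : Euc n => p 0) := by fun_prop
  exact (isClosed_le continuous_const hc).inter
    (isClosed_le cuspRho_continuous ((cusp_v_continuous hu).comp hc))

lemma cuspBall_open {n : ℕ} [NeZero n] {u : ℝ → ℝ} (hu : IsModelCusp u) :
    IsOpen (cuspBall n u) := by
  rw [cuspBall_eq]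
  exact Metric.isOpen_ball.sdiff (cuspSet_closed hu)

lemma cusp_u_zero {u : ℝ → ℝ} (hu : IsModelCusp u) : u 0 = 0 := by
  obtain ⟨a, ha, hau⟩ := hu.surjOn (show (0 : ℝ) ∈ Set.Ici 0 by simp)
  have h1 := hu.strictMonoOn.monotoneOn (show (0 : ℝ) ∈ Set.Ici 0 by simp) ha ha
  have h2 : 0 ≤ u 0 := hu.mapsTo (show (0 : ℝ) ∈ Set.Ici 0 by simp)
  linarith

/-- The vertical unit vector. -/
def cuspE (n : ℕ) [NeZero n] : Euc n := EuclideanSpace.single 0 1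

lemma cuspE_norm (n : ℕ) [NeZero n] : ‖cuspE n‖ = 1 := by
  simp [cuspE]

lemma cusp_sub_zero {n : ℕ} [NeZero n] (p : Euc n) (r : ℝ) : (p - r • cuspE n) 0 = p 0 - r := by
  simp [cuspE]

lemma cusp_sub_rho {n : ℕ} [NeZero n] (p : Euc n) (r : ℝ) :
    cuspRho (p - r • cuspE n) = cuspRho p := by
  unfold cuspRho
  congr 1
  apply Finset.sum_congr rfl
  intro i hi
  have : i ≠ 0 := Finset.ne_of_mem_erase hi
  simp [cuspE, this]

lemma cusp_sub_notMem {n : ℕ} [NeZero n] {u : ℝ → ℝ} (hu : IsModelCusp u) (p : Euc n) (r : ℝ)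
    (hr : 0 ≤ r) (hp : p ∉ cuspSet n u) : p - r • cuspE n ∉ cuspSet n u := by
  rintro ⟨h1, h2⟩
  rw [cusp_sub_zero] at h1 h2
  rw [cusp_sub_rho] at h2
  apply hp
  have h0 : 0 ≤ p 0 := by linarith
  refine ⟨h0, h2.trans ?_⟩
  exact hu.strictMonoOn.monotoneOn h1 h0 (by linarith)

/-- Boundary local connectedness at `y`. -/
def CuspLC {n : ℕ} (Y : Set (Euc n)) (y : Euc n) : Prop :=
  ∀ ε > 0, ∃ δ > 0, ∀ p ∈ Y ∩ ball y δ, ∀ q ∈ Y ∩ ball y δ,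
    ∃ V ⊆ Y ∩ ball y ε, IsPreconnected V ∧ p ∈ V ∧ q ∈ V

lemma cuspLC_of_notMem {n : ℕ} [NeZero n] {u : ℝ → ℝ} (hu : IsModelCusp u) (y : Euc n)
    (hy : y ∉ cuspSet n u) : CuspLC (cuspBall n u) y := by
  intro ε hε
  obtain ⟨d, hd, hdU⟩ := Metric.isOpen_iff.1 (cuspSet_closed (n := n) hu).isOpen_compl y hy
  have hsub : ball (0 : Euc n) 1 ∩ ball y (min d ε) ⊆ cuspBall n u ∩ ball y ε := by
    rintro p ⟨h1, h2⟩
    exact ⟨⟨h1, hdU (ball_subset_ball (min_le_left _ _) h2)⟩,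
      ball_subset_ball (min_le_right _ _) h2⟩
  refine ⟨min d ε, lt_min hd hε, fun p hp q hq => ⟨_, hsub, ?_, ⟨hp.1.1, hp.2⟩, ⟨hq.1.1, hq.2⟩⟩⟩
  exact ((convex_ball _ _).inter (convex_ball _ _)).isPreconnected

lemma cuspLC_of_shift {n : ℕ} [NeZero n] {u : ℝ → ℝ} (hu : IsModelCusp u) (y : Euc n)
    (hy : ∀ ε : ℝ, 0 < ε → ∃ r : ℝ, 0 < r ∧ r < ε ∧ y - r • cuspE n ∈ cuspBall n u) :
    CuspLC (cuspBall n u) y := by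
  intro ε hε
  obtain ⟨r, hr, hrε, hw⟩ := hy (ε / 2) (by linarith)
  obtain ⟨d, hd, hdU⟩ := Metric.isOpen_iff.1 (cuspBall_open (n := n) hu) _ hw
  have hre : ‖r • cuspE n‖ = r := by
    rw [norm_smul, cuspE_norm, Real.norm_of_nonneg hr.le, mul_one]
  have key : ∀ δ ≤ ε / 2, ball (y - r • cuspE n) δ ⊆ ball y ε := by
    intro δ hδ
    apply ball_subset_ball'
    rw [dist_eq_norm, sub_sub_cancel_left, norm_neg, hre]
    linarith
  have sh : ∀ δ, ∀ p ∈ ball y δ, p - r • cuspE n ∈ ball (y - r • cuspE n) δ := by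
    intro δ p hp
    rw [mem_ball, dist_sub_right]
    exact hp
  set δ := min d (ε / 2) with hδ
  have hδε : δ ≤ ε / 2 := min_le_right _ _
  have hδd : δ ≤ d := min_le_left _ _
  have hball : ball (y - r • cuspE n) δ ⊆ cuspBall n u ∩ ball y ε := fun p hp =>
    ⟨hdU (ball_subset_ball hδd hp), key δ hδε hp⟩
  have hseg : ∀ p ∈ cuspBall n u ∩ ball y δ,
      segment ℝ p (p - r • cuspE n) ⊆ cuspBall n u ∩ ball y ε := by
    intro p hp z hz
    have hp' := hball (sh δ p hp.2)
    refine ⟨⟨(convex_ball _ _).segment_subset hp.1.1 hp'.1.1 hz, ?_⟩,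
      (convex_ball _ _).segment_subset (ball_subset_ball (by linarith) hp.2) hp'.2 hz⟩
    obtain ⟨a, b, ha, hb, hab, rfl⟩ := hz
    have : a • p + b • (p - r • cuspE n) = p - (b * r) • cuspE n := by
      rw [smul_sub, smul_smul, ← add_sub_assoc, ← add_smul, hab, one_smul]
    rw [this]
    exact cusp_sub_notMem hu p _ (by positivity) hp.1.2
  refine ⟨δ, lt_min hd (by linarith), fun p hp q hq =>
    ⟨(segment ℝ p (p - r • cuspE n) ∪ ball (y - r • cuspE n) δ) ∪
      segment ℝ q (q - r • cuspE n), ?_, ?_, ?_, ?_⟩⟩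
  · exact union_subset (union_subset (hseg p hp) hball) (hseg q hq)
  · refine IsPreconnected.union (q - r • cuspE n) (Or.inr (sh δ q hq.2))
      (right_mem_segment _ _ _) ?_ (convex_segment _ _).isPreconnected
    exact IsPreconnected.union (p - r • cuspE n) (right_mem_segment _ _ _) (sh δ p hp.2)
      (convex_segment _ _).isPreconnected (convex_ball _ _).isPreconnected
  · exact Or.inl (Or.inl (left_mem_segment _ _ _))
  · exact Or.inr (left_mem_segment _ _ _)

lemma cusp_rho_ge {n : ℕ} [NeZero n] {u : ℝ → ℝ} (hu : IsModelCusp u) (y : Euc n)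
    (hy : y ∈ closure (cuspBall n u)) (hs : 0 < y 0) : u (y 0) ≤ cuspRho y := by
  by_contra! hlt
  have hc : Continuous (fun p : Euc n => p 0) := by fun_prop
  have hopen : IsOpen ({p : Euc n | 0 < p 0} ∩ {p | cuspRho p < u (max (p 0) 0)}) :=
    (isOpen_lt continuous_const hc).inter
      (isOpen_lt cuspRho_continuous ((cusp_v_continuous hu).comp hc))
  obtain ⟨p, ⟨h1, h2⟩, h3⟩ := mem_closure_iff.1 hy _ hopen
    ⟨hs, by simpa [max_eq_left hs.le] using hlt⟩
  have h1' : 0 < p 0 := h1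
  have h2' : cuspRho p < u (max (p 0) 0) := h2
  rw [max_eq_left h1'.le] at h2'
  exact h3.2 ⟨h1'.le, h2'.le⟩

lemma cusp_norm_sq {n : ℕ} [NeZero n] (p : Euc n) : ‖p‖ ^ 2 = p 0 ^ 2 + cuspRho p ^ 2 := by
  rw [EuclideanSpace.real_norm_sq_eq, cuspRho,
    Real.sq_sqrt (Finset.sum_nonneg fun i _ => sq_nonneg _),
    Finset.add_sum_erase _ (fun i => p i ^ 2) (Finset.mem_univ 0)]

lemma cuspLC_closure {n : ℕ} [NeZero n] {u : ℝ → ℝ} (hu : IsModelCusp u) (y : Euc n)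
    (hy : y ∈ closure (cuspBall n u)) : CuspLC (cuspBall n u) y := by
  by_cases hC : y ∈ cuspSet n u
  swap
  · exact cuspLC_of_notMem hu y hC
  apply cuspLC_of_shift hu
  intro ε hε
  have hy1 : ‖y‖ ≤ 1 := by
    have := closure_ball_subset_closedBall (closure_mono (show cuspBall n u ⊆ ball 0 1 from
      fun p hp => hp.1) hy)
    simpa using this
  have hy2 := cusp_norm_sq y
  have hmem : ∀ r : ℝ, ‖y - r • cuspE n‖ ^ 2 < 1 → y - r • cuspE n ∈ ball (0 : Euc n) 1 := by
    intro r h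
    rw [mem_ball_zero_iff]
    nlinarith [norm_nonneg (y - r • cuspE n)]
  obtain ⟨h0, h1⟩ := hC
  rcases h0.eq_or_lt with hs | hs
  · rw [← hs, cusp_u_zero hu] at h1
    have h2 : cuspRho y = 0 := le_antisymm h1 (Real.sqrt_nonneg _)
    refine ⟨min (ε / 2) (1 / 2), by positivity, (min_le_left _ _).trans_lt (by linarith), ?_, ?_⟩
    · apply hmem
      rw [cusp_norm_sq, cusp_sub_zero, cusp_sub_rho, h2, ← hs]
      have a1 : 0 < min (ε / 2) (1 / 2) := by positivity
      have a2 : min (ε / 2) (1 / 2) ≤ 1 / 2 := min_le_right _ _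
      nlinarith
    · rintro ⟨h3, -⟩
      rw [cusp_sub_zero, ← hs] at h3
      have a1 : 0 < min (ε / 2) (1 / 2) := by positivity
      linarith
  · have h2 := cusp_rho_ge hu y hy hs
    have a1 : 0 < min (ε / 2) (y 0) := by positivity
    have a2 : min (ε / 2) (y 0) ≤ y 0 := min_le_right _ _
    refine ⟨min (ε / 2) (y 0), a1, (min_le_left _ _).trans_lt (by linarith), ?_, ?_⟩
    · apply hmem
      rw [cusp_norm_sq, cusp_sub_zero, cusp_sub_rho]
      nlinarith [norm_nonneg y]
    · rintro ⟨h3, h4⟩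
      rw [cusp_sub_zero] at h3 h4
      change cuspRho (y - min (ε / 2) (y 0) • cuspE n) ≤ _ at h4
      rw [cusp_sub_rho] at h4
      have := hu.strictMonoOn h3 h0 (show y 0 - min (ε / 2) (y 0) < y 0 by linarith)
      linarith

/-- If `h : 𝔹 → 𝔹_u` is a `W^{1,n}`-homeomorphism and `H` a continuous
extension to the closures, then for each `y ∈ ∂𝔹_u` the preimage `H⁻¹(y)` is a nonempty
compact connected subset of `∂𝔹`. -/
theorem stmt_12 {n : ℕ} [NeZero n] (hn : 3 ≤ n) (u : ℝ → ℝ) (hu : IsModelCusp u)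
    (h f : Euc n → Euc n) (hhf : IsHomeoOn h f (unitBall n) (cuspBall n u))
    (Dh : Euc n → Matrix (Fin n) (Fin n) ℝ)
    (hSob : MemSobolev (n : ℝ) (unitBall n) h Dh)
    (H : Euc n → Euc n) (hHc : ContinuousOn H (closure (unitBall n)))
    (hHmaps : Set.MapsTo H (closure (unitBall n)) (closure (cuspBall n u)))
    (hHeq : Set.EqOn H h (unitBall n)) :
    ∀ y ∈ frontier (cuspBall n u),
      {x ∈ closure (unitBall n) | H x = y}.Nonempty ∧
      IsCompact {x ∈ closure (unitBall n) | H x = y} ∧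
      IsConnected {x ∈ closure (unitBall n) | H x = y} ∧
      {x ∈ closure (unitBall n) | H x = y} ⊆ Metric.sphere (0 : Euc n) 1 := by
  intro y hy
  have hopen := cuspBall_open (n := n) hu
  have hyc : y ∈ closure (cuspBall n u) := frontier_subset_closure hy
  have hyn : y ∉ cuspBall n u := by
    rw [hopen.frontier_eq] at hy
    exact hy.2
  have hcl : closure (unitBall n) = closedBall 0 1 := by
    unfold unitBall
    exact closure_ball 0 one_ne_zero
  have hK : IsCompact (closure (unitBall n)) := by
    rw [hcl]
    exact isCompact_closedBall _ _
  have hcomp : IsCompact {x ∈ closure (unitBall n) | H x = y} := by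
    have := hHc.preimage_isClosed_of_isClosed isClosed_closure (isClosed_singleton (x := y))
    exact hK.of_isClosed_subset this (fun x hx => hx.1)
  have hne : {x ∈ closure (unitBall n) | H x = y}.Nonempty := by
    have hc : IsClosed (H '' closure (unitBall n)) := (hK.image_of_continuousOn hHc).isClosed
    have hs : cuspBall n u ⊆ H '' closure (unitBall n) := by
      intro z hz
      refine ⟨f z, subset_closure (hhf.mapsTo_inv hz), ?_⟩
      rw [hHeq (hhf.mapsTo_inv hz), hhf.right_inv z hz]
    obtain ⟨x, hx, hxy⟩ := closure_minimal hs hc hyc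
    exact ⟨x, hx, hxy⟩
  refine ⟨hne, hcomp, ⟨hne, ?_⟩, ?_⟩
  · rw [isPreconnected_iff_subset_of_fully_disjoint_closed hcomp.isClosed]
    intro A B hA hB hAB hdisj
    by_contra! hcon
    obtain ⟨hnA, hnB⟩ := hcon
    obtain ⟨b, hbS, hbA⟩ := Set.not_subset.1 hnA
    obtain ⟨a, haS, haB⟩ := Set.not_subset.1 hnB
    have haA : a ∈ A := (hAB haS).resolve_right haB
    have hbB : b ∈ B := (hAB hbS).resolve_left hbA
    obtain ⟨U, W, hU, hW, hAU, hBW, hUW⟩ := normal_separation hA hB hdisj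
    -- a neighbourhood of `y` whose preimage lies in `U ∪ W`
    obtain ⟨ε, hε, hεU⟩ : ∃ ε > 0, ∀ x ∈ closure (unitBall n), H x ∈ ball y ε → x ∈ U ∪ W := by
      have hK2 : IsCompact (closure (unitBall n) \ (U ∪ W)) := hK.diff (hU.union hW)
      have hc2 : IsClosed (H '' (closure (unitBall n) \ (U ∪ W))) :=
        (hK2.image_of_continuousOn (hHc.mono diff_subset)).isClosed
      have hy2 : y ∉ H '' (closure (unitBall n) \ (U ∪ W)) := by
        rintro ⟨x, ⟨hx1, hx2⟩, hxy⟩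
        exact hx2 ((hAB ⟨hx1, hxy⟩).imp (fun h => hAU h) (fun h => hBW h))
      obtain ⟨ε, hε, hsub⟩ := Metric.isOpen_iff.1 hc2.isOpen_compl y hy2
      refine ⟨ε, hε, fun x hx hxe => ?_⟩
      by_contra hn
      exact hsub hxe ⟨x, ⟨hx, hn⟩, rfl⟩
    obtain ⟨δ, hδ, hLC⟩ := cuspLC_closure hu y hyc ε hε
    have pick : ∀ x ∈ {x ∈ closure (unitBall n) | H x = y}, ∀ O : Set (Euc n), IsOpen O → x ∈ O →
        ∃ z ∈ unitBall n, z ∈ O ∧ h z ∈ cuspBall n u ∩ ball y δ := by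
      intro x hx O hO hxO
      have h1 : H ⁻¹' ball y δ ∈ nhdsWithin x (closure (unitBall n)) := by
        apply hHc x hx.1
        rw [hx.2]
        exact ball_mem_nhds y hδ
      have h2 : H ⁻¹' ball y δ ∈ nhdsWithin x (unitBall n) := nhdsWithin_mono x subset_closure h1
      have h3 : O ∈ nhdsWithin x (unitBall n) := mem_nhdsWithin_of_mem_nhds (hO.mem_nhds hxO)
      haveI : (nhdsWithin x (unitBall n)).NeBot := mem_closure_iff_nhdsWithin_neBot.1 hx.1
      obtain ⟨z, ⟨hz1, hz2⟩, hz3⟩ := Filter.nonempty_of_mem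
        (Filter.inter_mem (Filter.inter_mem h2 h3) self_mem_nhdsWithin)
      refine ⟨z, hz3, hz2, hhf.mapsTo hz3, ?_⟩
      rw [← hHeq hz3]
      exact hz1
    obtain ⟨p, hp, hpU, hpV⟩ := pick a haS U hU (hAU haA)
    obtain ⟨q, hq, hqW, hqV⟩ := pick b hbS W hW (hBW hbB)
    obtain ⟨V, hVsub, hV, hpV', hqV'⟩ := hLC _ hpV _ hqV
    have hfV : IsPreconnected (f '' V) :=
      hV.image f (hhf.continuousOn_inv.mono fun z hz => (hVsub hz).1)
    have hfsub : f '' V ⊆ U ∪ W := by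
      rintro _ ⟨z, hz, rfl⟩
      have hz1 := hhf.mapsTo_inv (hVsub hz).1
      apply hεU _ (subset_closure hz1)
      rw [hHeq hz1, hhf.right_inv z (hVsub hz).1]
      exact (hVsub hz).2
    have hpf : p ∈ f '' V := ⟨h p, hpV', hhf.left_inv p hp⟩
    have hqf : q ∈ f '' V := ⟨h q, hqV', hhf.left_inv q hq⟩
    obtain ⟨z, -, hzU, hzW⟩ := hfV U W hU hW hfsub ⟨p, hpf, hpU⟩ ⟨q, hqf, hqW⟩
    exact Set.disjoint_left.1 hUW hzU hzW
  · rintro x ⟨hx, hxy⟩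
    have hx1 : ‖x‖ ≤ 1 := by
      rw [hcl] at hx
      simpa using hx
    rw [mem_sphere_zero_iff_norm]
    by_contra hne1
    have hxb : x ∈ unitBall n := by
      unfold unitBall
      rw [mem_ball_zero_iff]
      exact lt_of_le_of_ne hx1 hne1
    apply hyn
    rw [← hxy, hHeq hxb]
    exact hhf.mapsTo hxb
end
end
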